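/- arXiv:2411.12840 — 7 statements merged into one kernel-verified Lean document; each statement's English description precedes it below -/
import Mathlib

section
/- The category Stoch of measurable spaces and Markov kernels satisfies the Cauchy–Schwarz axiom: let A, X, Y be measurable spaces and let p : A → X and f, g : X → Y be Markov kernels. If for every a ∈ A and every measurable set D ⊆ Y one has ∫_X f(D|x)² p(dx|a) = ∫_X f(D|x)·g(D|x) p(dx|a) = ∫_X g(D|x)² p(dx|a), then f and g are p-almost surely equal, i.e. for every a ∈ A and all measurable sets E ⊆ X and D ⊆ Y, ∫_E f(D|x) p(dx|a) = ∫_E g(D|x) p(dx|a). -/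
open MeasureTheory ProbabilityTheory

/-- The equality case of the Cauchy–Schwarz inequality for square-integrable functions:
if `∫ u² = ∫ u v = ∫ v²` is finite, then `u = v` almost everywhere. -/
theorem ae_eq_of_lintegral_mul_self_eq {X : Type*} [MeasurableSpace X] {μ : Measure X}
    {u v : X → ENNReal} (hu : AEMeasurable u μ) (hv : AEMeasurable v μ)
    (hfin : ∫⁻ x, u x * u x ∂μ ≠ ⊤)
    (huv : ∫⁻ x, u x * u x ∂μ = ∫⁻ x, u x * v x ∂μ)
    (hvv : ∫⁻ x, u x * v x ∂μ = ∫⁻ x, v x * v x ∂μ) :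
    u =ᵐ[μ] v := by
  have hfin_uv : ∫⁻ x, u x * v x ∂μ ≠ ⊤ := huv ▸ hfin
  have hfin_vv : ∫⁻ x, v x * v x ∂μ ≠ ⊤ := hvv ▸ hfin_uv
  have lt_uu := ae_lt_top' (hu.mul hu) hfin
  have lt_uv := ae_lt_top' (hu.mul hv) hfin_uv
  have lt_vv := ae_lt_top' (hv.mul hv) hfin_vv
  have int_uu := integrable_toReal_of_lintegral_ne_top (hu.mul hu) hfin
  have int_uv := integrable_toReal_of_lintegral_ne_top (hu.mul hv) hfin_uv
  have int_vv := integrable_toReal_of_lintegral_ne_top (hv.mul hv) hfin_vv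
  have eq_uu := integral_toReal (hu.mul hu) lt_uu
  have eq_uv := integral_toReal (hu.mul hv) lt_uv
  have eq_vv := integral_toReal (hv.mul hv) lt_vv
  simp only [Pi.mul_apply, ENNReal.toReal_mul] at *
  have expand : ∀ x, ((u x).toReal - (v x).toReal) ^ 2 =
      (u x).toReal * (u x).toReal - 2 * ((u x).toReal * (v x).toReal) +
        (v x).toReal * (v x).toReal := fun x => by ring
  have int_sub : Integrable (fun x => (u x).toReal * (u x).toReal -
      2 * ((u x).toReal * (v x).toReal)) μ := int_uu.sub (int_uv.const_mul 2)
  have int_sq : Integrable (fun x => ((u x).toReal - (v x).toReal) ^ 2) μ := by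
    simp only [expand]
    exact int_sub.add int_vv
  have hzero : ∫ x, ((u x).toReal - (v x).toReal) ^ 2 ∂μ = 0 := by
    simp only [expand]
    rw [integral_add int_sub int_vv,
      integral_sub int_uu (int_uv.const_mul 2), integral_const_mul, eq_uu, eq_uv, eq_vv,
      huv, hvv]
    ring
  rw [integral_eq_zero_iff_of_nonneg (fun x => sq_nonneg _) int_sq] at hzero
  filter_upwards [hzero, lt_uu, lt_vv] with x hx hux hvx
  have ne_top_of_sq {a : ENNReal} (ha : a * a < ⊤) : a ≠ ⊤ := by
    rintro rfl
    simp at ha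
  exact (ENNReal.toReal_eq_toReal_iff' (ne_top_of_sq hux) (ne_top_of_sq hvx)).mp
    (sub_eq_zero.mp (pow_eq_zero_iff two_ne_zero |>.mp hx))

/-- **The Cauchy–Schwarz axiom holds in `Stoch`**: if `p : A → X` and `f, g : X → Y` are
Markov kernels such that for every `a` and every measurable `D ⊆ Y` the three integrals
`∫ f(D|x)² dp(x|a)`, `∫ f(D|x)·g(D|x) dp(x|a)` and `∫ g(D|x)² dp(x|a)` coincide, then `f`
and `g` are `p`-almost surely equal, i.e. `∫_E f(D|x) dp(x|a) = ∫_E g(D|x) dp(x|a)` for all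
`a`, all measurable `E ⊆ X` and all measurable `D ⊆ Y`. -/
theorem stoch_cauchy_schwarz
    {A X Y : Type*} [MeasurableSpace A] [MeasurableSpace X] [MeasurableSpace Y]
    (p : Kernel A X) (f g : Kernel X Y)
    [IsMarkovKernel p] [IsMarkovKernel f] [IsMarkovKernel g]
    (h : ∀ (a : A) (D : Set Y), MeasurableSet D →
      (∫⁻ x, f x D * f x D ∂(p a)) = (∫⁻ x, f x D * g x D ∂(p a)) ∧
      (∫⁻ x, f x D * g x D ∂(p a)) = (∫⁻ x, g x D * g x D ∂(p a))) :
    ∀ (a : A) (E : Set X), MeasurableSet E → ∀ (D : Set Y), MeasurableSet D →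
      (∫⁻ x in E, f x D ∂(p a)) = (∫⁻ x in E, g x D ∂(p a)) := by
  intro a E _ D hD
  obtain ⟨huv, hvv⟩ := h a D hD
  have hfin : ∫⁻ x, f x D * f x D ∂(p a) ≠ ⊤ := by
    refine ((lintegral_mono (g := fun _ => 1) fun x => ?_).trans_lt (by simp)).ne
    exact mul_le_one' prob_le_one prob_le_one
  exact lintegral_congr_ae <| ae_restrict_of_ae <|
    ae_eq_of_lintegral_mul_self_eq (f.measurable_coe hD).aemeasurable
      (g.measurable_coe hD).aemeasurable hfin huv hvv
end

section
/- De Finetti Theorem (weak form): let X be a standard Borel space and let p be an exchangeable probability measure on ℕ → X. Then there exist a standard Borel space A, a probability measure q on A, and a Markov kernel f : A → X such that p equals the bind of q with the map sending a ∈ A to the countable product measure (f a)^{⊗ℕ} on ℕ → X (all factors equal to f a); that is, p = ∫_A (f a)^{⊗ℕ} dq(a). -/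
open MeasureTheory ProbabilityTheory

/-- `ν` is the product of the probability measures `μ i` over the (possibly infinite) index
set `ι`: every finite-dimensional cylinder set has the product measure. (For probability
measures this characterizes the countable product measure uniquely.) -/
def IsProductMeasure {ι : Type*} {α : ι → Type*} [∀ i, MeasurableSpace (α i)]
    (μ : ∀ i, Measure (α i)) (ν : Measure (∀ i, α i)) : Prop :=
  ∀ (s : Finset ι) (t : ∀ i, Set (α i)), (∀ i, MeasurableSet (t i)) →
    ν {x | ∀ i ∈ s, x i ∈ t i} = ∏ i ∈ s, μ i (t i)

/-- A measure on `ℕ → X` is exchangeable if it is invariant under every permutation of `ℕ`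
fixing all but finitely many elements. -/
def Exchangeable {X : Type*} [MeasurableSpace X] (p : Measure (ℕ → X)) : Prop :=
  ∀ σ : Equiv.Perm ℕ, {n | σ n ≠ n}.Finite → p.map (fun x => x ∘ σ) = p

/-- `p` is a mixture of iid measures with mixing space `A`: `A` is standard Borel and there
are a probability measure `q` on `A` and a Markov kernel `f : A → X` such that
`p = ∫_A (f a)^{⊗ℕ} dq(a)`, where `(f a)^{⊗ℕ}` is the countable product with all factors
equal to `f a`. -/
def IsDeFinettiMixture {X : Type*} [MeasurableSpace X] (p : Measure (ℕ → X))
    (A : Type) [MeasurableSpace A] : Prop :=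
  StandardBorelSpace A ∧
    ∃ q : Measure A, IsProbabilityMeasure q ∧
      ∃ f : Kernel A X, IsMarkovKernel f ∧
        ∃ P : A → Measure (ℕ → X), Measurable P ∧
          (∀ a, IsProductMeasure (fun _ : ℕ => f a) (P a)) ∧
          p = q.bind P

open scoped ENNReal

/-- On an initial segment, an injection `ℕ → ℕ` agrees with a finitely supported permutation. -/
lemma exists_finite_perm_eq_of_lt {ι : ℕ → ℕ} (hι : ι.Injective) (n : ℕ) :
    ∃ σ : Equiv.Perm ℕ, {k | σ k ≠ k}.Finite ∧ ∀ i < n, σ i = ι i := by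
  induction n with
  | zero => exact ⟨1, by simp, by simp⟩
  | succ n ih =>
    obtain ⟨σ, hσ, h⟩ := ih
    refine ⟨Equiv.swap (σ n) (ι n) * σ, ?_, fun i hi => ?_⟩
    · refine (hσ.union (Set.toFinite {n, σ.symm (ι n)})).subset fun k hk => ?_
      by_contra hk'
      simp only [Set.mem_union, Set.mem_ofPred_eq, Set.mem_insert_iff, Set.mem_singleton_iff,
        not_or, not_not] at hk'
      refine hk ?_
      rw [Equiv.Perm.mul_apply, Equiv.swap_apply_of_ne_of_ne, hk'.1]
      · exact fun h' => hk'.2.1 (σ.injective h')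
      · exact fun h' => hk'.2.2 (by rw [← h', Equiv.symm_apply_apply])
    · rcases Nat.lt_succ_iff_lt_or_eq.mp hi with hi | rfl
      · rw [Equiv.Perm.mul_apply, h i hi, Equiv.swap_apply_of_ne_of_ne]
        · rw [← h i hi]
          exact fun h' => hi.ne (σ.injective h')
        · exact fun h' => hi.ne (hι h')
      · simp

lemma measurable_comp_reindex {X : Type*} [MeasurableSpace X] (τ : ℕ → ℕ) :
    Measurable fun x : ℕ → X => x ∘ τ :=
  measurable_pi_lambda _ fun i => measurable_pi_apply (τ i)

namespace Exchangeable

variable {X : Type*} [MeasurableSpace X] {p : Measure (ℕ → X)}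

/-- An exchangeable finite measure is invariant under reindexing along any injection. -/
lemma map_comp_injective [IsFiniteMeasure p] (hp : Exchangeable p) {ι : ℕ → ℕ}
    (hι : ι.Injective) : p.map (fun x => x ∘ ι) = p := by
  refine IsProjectiveLimit.unique (P := fun I => p.map I.restrict) (fun I => ?_) fun I => rfl
  obtain ⟨σ, hσ, h⟩ := exists_finite_perm_eq_of_lt hι (I.sup id + 1)
  change _ = p.map I.restrict
  conv_rhs => rw [← hp σ hσ]
  rw [Measure.map_map (Finset.measurable_restrict I) (measurable_comp_reindex _),
    Measure.map_map (Finset.measurable_restrict I) (measurable_comp_reindex _)]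
  congr 1
  ext x i
  have hi : (i : ℕ) < I.sup id + 1 := Nat.lt_succ_of_le (Finset.le_sup (f := id) i.2)
  simp [h i hi]

lemma lintegral_comp_injective [IsFiniteMeasure p] (hp : Exchangeable p) {ι : ℕ → ℕ}
    (hι : ι.Injective) {F : (ℕ → X) → ℝ≥0∞} (hF : Measurable F) :
    ∫⁻ x, F (x ∘ ι) ∂p = ∫⁻ x, F x ∂p := by
  conv_rhs => rw [← hp.map_comp_injective hι]
  rw [lintegral_map hF (measurable_comp_reindex ι)]

end Exchangeable

section Directing

variable {X : Type*} [MeasurableSpace X] [StandardBorelSpace X] [Nonempty X]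
  {p : Measure (ℕ → X)} [IsProbabilityMeasure p]

/-- The conditional law of the first coordinate given all the later ones. -/
noncomputable def directingKernel (p : Measure (ℕ → X)) [IsFiniteMeasure p] :
    Kernel (ℕ → X) X :=
  condDistrib (fun x => x 0) (fun x => x ∘ Nat.succ) p

instance : IsMarkovKernel (directingKernel p) := by
  unfold directingKernel
  infer_instance

/-- The directing kernel is also the conditional law of the first coordinate given any
infinite subsequence of the later ones. -/
lemma lintegral_indicator_mul_eq_directingKernel (hp : Exchangeable p) {ι : ℕ → ℕ}
    (hι : ι.Injective) (h0 : ∀ i, ι i ≠ 0) {t : Set X} (ht : MeasurableSet t)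
    {g : (ℕ → X) → ℝ≥0∞} (hg : Measurable g) :
    ∫⁻ x, t.indicator 1 (x 0) * g (x ∘ ι) ∂p
      = ∫⁻ x, directingKernel p (x ∘ ι) t * g (x ∘ ι) ∂p := by
  have hind : Measurable (t.indicator (1 : X → ℝ≥0∞)) := measurable_one.indicator ht
  have hκ : Measurable fun y => directingKernel p y t := Kernel.measurable_coe _ ht
  have hprod : Measurable fun z : (ℕ → X) × X => t.indicator 1 z.2 * g z.1 := by fun_prop
  have hsucc : ∫⁻ x, t.indicator 1 (x 0) * g (x ∘ Nat.succ) ∂p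
      = ∫⁻ x, directingKernel p (x ∘ Nat.succ) t * g (x ∘ Nat.succ) ∂p := by
    have h := compProd_map_condDistrib (mβ := MeasurableSpace.pi) (μ := p)
      (X := fun x => x ∘ Nat.succ) (measurable_pi_apply 0).aemeasurable
    have h' := congrArg (fun m => ∫⁻ z, t.indicator 1 z.2 * g z.1 ∂m) h
    rw [Measure.lintegral_compProd hprod,
      lintegral_map hprod ((measurable_comp_reindex _).prodMk (measurable_pi_apply 0))] at h'
    rw [← h', lintegral_map hprod.lintegral_kernel_prod_right' (measurable_comp_reindex _)]
    refine lintegral_congr fun x => ?_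
    dsimp only
    rw [lintegral_mul_const _ hind, lintegral_indicator_one ht]
    rfl
  let τ : ℕ → ℕ := fun n => Nat.casesOn n 0 ι
  have hτ : τ.Injective := by
    rintro (_ | i) (_ | j) hij
    · rfl
    · exact absurd hij.symm (h0 j)
    · exact absurd hij (h0 i)
    · exact congrArg Nat.succ (hι hij)
  have hgs : Measurable fun x : ℕ → X => g (x ∘ Nat.succ) := hg.comp (measurable_comp_reindex _)
  have hκs : Measurable fun x : ℕ → X => directingKernel p (x ∘ Nat.succ) t :=
    hκ.comp (measurable_comp_reindex _)
  have h0m : Measurable fun x : ℕ → X => t.indicator (1 : X → ℝ≥0∞) (x 0) :=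
    hind.comp (measurable_pi_apply 0)
  exact (hp.lintegral_comp_injective hτ (h0m.mul hgs)).trans
    (hsucc.trans (hp.lintegral_comp_injective hτ (hκs.mul hgs)).symm)

/-- Conditioning the first coordinate on all later ones or only on an infinite subsequence of
them gives the same result. -/
lemma directingKernel_comp_ae_eq (hp : Exchangeable p) {ι : ℕ → ℕ} (hι : ι.Injective)
    {t : Set X} (ht : MeasurableSet t) :
    (fun x => directingKernel p (x ∘ Nat.succ) t)
      =ᵐ[p] fun x => directingKernel p (x ∘ (Nat.succ ∘ ι)) t := by
  have hκ : Measurable fun y => directingKernel p y t := Kernel.measurable_coe _ ht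
  have hκτ (τ : ℕ → ℕ) : Measurable fun x : ℕ → X => directingKernel p (x ∘ τ) t :=
    hκ.comp (measurable_comp_reindex τ)
  set a := fun x : ℕ → X => directingKernel p (x ∘ Nat.succ) t
  set b := fun x : ℕ → X => directingKernel p (x ∘ (Nat.succ ∘ ι)) t
  have ha : Measurable a := hκτ _
  have hb : Measurable b := hκτ _
  have hsι : (Nat.succ ∘ ι).Injective := Nat.succ_injective.comp hι
  have haa : ∫⁻ x, a x * a x ∂p = ∫⁻ x, b x * b x ∂p :=
    (hp.lintegral_comp_injective Nat.succ_injective (hκ.mul hκ)).trans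
      (hp.lintegral_comp_injective hsι (hκ.mul hκ)).symm
  have hab : ∫⁻ x, a x * b x ∂p = ∫⁻ x, b x * b x ∂p :=
    (lintegral_indicator_mul_eq_directingKernel hp Nat.succ_injective Nat.succ_ne_zero ht
      (hκτ ι)).symm.trans
      (lintegral_indicator_mul_eq_directingKernel hp hsι (fun _ => Nat.succ_ne_zero _) ht hκ)
  have hsq (x : ℕ → X) : ENNReal.ofReal (((a x).toReal - (b x).toReal) ^ 2) + 2 * (a x * b x)
      = a x * a x + b x * b x := by
    have hax : a x ≠ ∞ := measure_ne_top _ _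
    have hbx : b x ≠ ∞ := measure_ne_top _ _
    rw [← ENNReal.ofReal_toReal hax, ← ENNReal.ofReal_toReal hbx,
      ← ENNReal.ofReal_ofNat 2, ← ENNReal.ofReal_mul (by positivity),
      ← ENNReal.ofReal_mul (by positivity), ← ENNReal.ofReal_mul (by positivity),
      ← ENNReal.ofReal_mul (by positivity), ← ENNReal.ofReal_add (by positivity) (by positivity),
      ← ENNReal.ofReal_add (by positivity) (by positivity),
      ENNReal.toReal_ofReal (by positivity), ENNReal.toReal_ofReal (by positivity)]
    congr 1
    ring
  have hfin : ∫⁻ x, b x * b x ∂p ≠ ∞ := by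
    refine ((lintegral_mono fun x => mul_le_one' prob_le_one prob_le_one).trans_lt
      (?_ : ∫⁻ _, 1 ∂p < ∞)).ne
    simp
  have hzero : ∫⁻ x, ENNReal.ofReal (((a x).toReal - (b x).toReal) ^ 2) ∂p = 0 := by
    have h := lintegral_congr (μ := p) hsq
    rw [lintegral_add_right _ (by fun_prop), lintegral_const_mul _ (by fun_prop),
      lintegral_add_left (by fun_prop), haa, hab, ← two_mul] at h
    exact (ENNReal.add_left_inj (ENNReal.mul_ne_top (by simp) hfin)).mp (h.trans (zero_add _).symm)
  rw [lintegral_eq_zero_iff (by fun_prop)] at hzero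
  filter_upwards [hzero] with x hx
  have hx' : ((a x).toReal - (b x).toReal) ^ 2 = 0 :=
    le_antisymm (ENNReal.ofReal_eq_zero.mp hx) (sq_nonneg _)
  exact (ENNReal.toReal_eq_toReal_iff' (measure_ne_top _ _) (measure_ne_top _ _)).mp
    (sub_eq_zero.mp (pow_eq_zero_iff two_ne_zero |>.mp hx'))

/-- Given the odd coordinates, the even ones are iid with law given by the directing kernel. -/
lemma lintegral_prod_indicator_even (hp : Exchangeable p) (n : ℕ) {t : ℕ → Set X}
    (ht : ∀ i, MeasurableSet (t i)) {g : (ℕ → X) → ℝ≥0∞} (hg : Measurable g) :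
    ∫⁻ x, (∏ i ∈ Finset.range n, (t i).indicator 1 (x (2 * i))) * g (x ∘ (2 * · + 1)) ∂p
      = ∫⁻ x, (∏ i ∈ Finset.range n, directingKernel p x (t i)) * g x ∂p := by
  have hodd : (fun i : ℕ => 2 * i + 1).Injective := fun i j h => by simpa using h
  induction n generalizing t g with
  | zero => simpa using hp.lintegral_comp_injective hodd hg
  | succ n ih =>
    have hind (i j : ℕ) : Measurable fun x : ℕ → X => (t i).indicator (1 : X → ℝ≥0∞) (x j) :=
      (measurable_one.indicator (ht i)).comp (measurable_pi_apply j)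
    have hκ : Measurable fun y => directingKernel p y (t 0) := Kernel.measurable_coe _ (ht 0)
    let G : (ℕ → X) → ℝ≥0∞ := fun y =>
      (∏ i ∈ Finset.range n, (t (i + 1)).indicator 1 (y (2 * i + 1))) * g (y ∘ (2 * ·))
    have hG : Measurable G :=
      (Finset.measurable_fun_prod _ fun i _ => hind _ _).mul (hg.comp (measurable_comp_reindex _))
    let ρ : ℕ → ℕ := fun k => if Even k then k + 2 else k
    have hρ : ρ.Injective := by
      intro i j h
      simp only [ρ, Nat.even_iff] at h
      split_ifs at h <;> omega
    have hρe (i : ℕ) : ρ (2 * i) = 2 * (i + 1) := by simp [ρ]; ring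
    have hρo (i : ℕ) : ρ (2 * i + 1) = 2 * i + 1 := by simp [ρ]
    calc _ = ∫⁻ x, (t 0).indicator 1 (x 0) * G (x ∘ Nat.succ) ∂p := by
          refine lintegral_congr fun x => ?_
          rw [Finset.prod_range_succ', mul_comm (∏ _ ∈ _, _), mul_assoc]
          rfl
      _ = ∫⁻ x, directingKernel p (x ∘ Nat.succ) (t 0) * G (x ∘ Nat.succ) ∂p :=
          lintegral_indicator_mul_eq_directingKernel hp Nat.succ_injective Nat.succ_ne_zero
            (ht 0) hG
      _ = ∫⁻ x, directingKernel p (x ∘ (2 * · + 1)) (t 0) * G (x ∘ Nat.succ) ∂p := by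
          refine lintegral_congr_ae ?_
          filter_upwards [directingKernel_comp_ae_eq hp (ι := (2 * ·))
            (fun i j h => by simpa using h) (ht 0)] with x hx
          rw [hx]
          rfl
      _ = ∫⁻ x, (∏ i ∈ Finset.range n, (t (i + 1)).indicator 1 (x (2 * i)))
            * (directingKernel p (x ∘ (2 * · + 1)) (t 0) * g (x ∘ (2 * · + 1))) ∂p := by
          refine Eq.trans ?_ (hp.lintegral_comp_injective hρ
            ((Finset.measurable_fun_prod _ fun i _ => hind _ _).mul
              ((hκ.comp (measurable_comp_reindex _)).mul (hg.comp (measurable_comp_reindex _)))))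
          refine lintegral_congr fun x => ?_
          have hodd' : (x ∘ ρ) ∘ (2 * · + 1) = x ∘ (2 * · + 1) := by
            ext i
            simp [hρo]
          simp only [Function.comp_apply, hρe]
          rw [hodd', mul_left_comm]
          rfl
      _ = ∫⁻ x, (∏ i ∈ Finset.range n, directingKernel p x (t (i + 1)))
            * (directingKernel p x (t 0) * g x) ∂p :=
          ih (fun i => ht _) (hκ.mul hg)
      _ = _ := by
          refine lintegral_congr fun x => ?_
          rw [Finset.prod_range_succ', mul_assoc]

/-- Finite-dimensional marginals of an exchangeable law in terms of its directing kernel. -/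
lemma measure_cylinder_eq_lintegral_directingKernel (hp : Exchangeable p) (s : Finset ℕ)
    {t : ℕ → Set X} (ht : ∀ i, MeasurableSet (t i)) :
    p ((s : Set ℕ).pi t) = ∫⁻ x, ∏ i ∈ s, directingKernel p x (t i) ∂p := by
  classical
  let u : ℕ → Set X := fun i => if i ∈ s then t i else Set.univ
  have hu (i : ℕ) : MeasurableSet (u i) := by
    by_cases hi : i ∈ s <;> simp [u, hi, ht]
  have hsub : s ⊆ Finset.range (s.sup id + 1) := fun i hi =>
    Finset.mem_range_succ_iff.mpr (Finset.le_sup (f := id) hi)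
  have h := lintegral_prod_indicator_even hp (s.sup id + 1) hu (g := 1) measurable_one
  simp only [Pi.one_apply, mul_one] at h
  have hprod (F : ℕ → Set X → ℝ≥0∞) (hF : ∀ i, F i Set.univ = 1) :
      ∏ i ∈ Finset.range (s.sup id + 1), F i (u i) = ∏ i ∈ s, F i (t i) := by
    rw [← Finset.prod_subset hsub fun i _ hi => by simp [u, hi, hF]]
    exact Finset.prod_congr rfl fun i hi => by simp [u, hi]
  have hS : MeasurableSet ((s : Set ℕ).pi t) :=
    MeasurableSet.pi s.countable_toSet fun i _ => ht i
  have hpi (x : ℕ → X) :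
      ((s : Set ℕ).pi t).indicator (1 : (ℕ → X) → ℝ≥0∞) x = ∏ i ∈ s, (t i).indicator 1 (x i) := by
    simp only [Set.indicator_apply, Set.mem_pi, Finset.mem_coe, Pi.one_apply,
      Finset.prod_ite_zero, Finset.prod_const_one]
  rw [← lintegral_indicator_one hS, ← hp.lintegral_comp_injective (ι := (2 * ·))
    (fun i j h => by simpa using h) (measurable_one.indicator hS)]
  simp_rw [hpi]
  convert h using 1
  · refine lintegral_congr fun x => ?_
    exact (hprod (fun i v => v.indicator 1 (x (2 * i))) (by simp)).symm
  · refine lintegral_congr fun x => ?_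
    exact (hprod (fun _ v => directingKernel p x v) (by simp)).symm

end Directing

/-- The law of an iid sequence depends measurably on the law of one term. -/
lemma measurable_infinitePi_kernel {A X : Type*} [MeasurableSpace A] [MeasurableSpace X]
    (f : Kernel A X) [IsMarkovKernel f] :
    Measurable fun a => Measure.infinitePi fun _ : ℕ => f a := by
  refine Measurable.measure_of_isPiSystem_of_isProbabilityMeasure
    generateFrom_squareCylinders.symm
    (isPiSystem_squareCylinders (fun _ => MeasurableSpace.isPiSystem_measurableSet) (by simp)) ?_
  rintro _ ⟨s, t, ht, rfl⟩
  have ht' (i : ℕ) : MeasurableSet (t i) := ht i (Set.mem_univ i)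
  simp_rw [Measure.infinitePi_pi _ fun i _ => ht' i]
  exact Finset.measurable_fun_prod _ fun i _ => Kernel.measurable_coe _ (ht' i)

/-- **De Finetti Theorem (weak form)**: every exchangeable probability measure on `ℕ → X`,
with `X` standard Borel, is a mixture of iid measures. -/
theorem deFinetti_weak {X : Type*} [MeasurableSpace X] [StandardBorelSpace X]
    (p : Measure (ℕ → X)) [IsProbabilityMeasure p] (hp : Exchangeable p) :
    ∃ (A : Type) (mA : MeasurableSpace A), @IsDeFinettiMixture X _ p A mA := by
  have : Nonempty (ℕ → X) := nonempty_of_isProbabilityMeasure p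
  have : Nonempty X := this.map (· 0)
  have he := measurableEmbedding_embeddingReal (ℕ → X)
  let f : Kernel ℝ X := (directingKernel p).comap he.invFun he.measurable_invFun
  refine ⟨ℝ, inferInstance, inferInstance, p.map (embeddingReal (ℕ → X)),
    Measure.isProbabilityMeasure_map he.measurable.aemeasurable, f, inferInstance,
    fun a => Measure.infinitePi fun _ => f a, measurable_infinitePi_kernel f,
    fun a s t ht => Measure.infinitePi_pi _ fun i _ => ht i, ?_⟩
  have hP := measurable_infinitePi_kernel f
  have hcyl {S : Set (ℕ → X)} (hS : MeasurableSet S) :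
      (p.map (embeddingReal (ℕ → X))).bind (fun a => Measure.infinitePi fun _ => f a) S
        = ∫⁻ x, Measure.infinitePi (fun _ : ℕ => directingKernel p x) S ∂p := by
    rw [Measure.bind_apply hS hP.aemeasurable]
    refine (lintegral_map ((Measure.measurable_coe hS).comp hP) he.measurable).trans ?_
    simp [f, Kernel.comap_apply, he.leftInverse_invFun _]
  refine ext_of_generate_finite _ generateFrom_squareCylinders.symm
    (isPiSystem_squareCylinders (fun _ => MeasurableSpace.isPiSystem_measurableSet) (by simp))
    ?_ (by rw [hcyl MeasurableSet.univ]; simp)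
  rintro _ ⟨s, t, ht, rfl⟩
  have ht' (i : ℕ) : MeasurableSet (t i) := ht i (Set.mem_univ i)
  rw [hcyl (MeasurableSet.pi s.countable_toSet fun i _ => ht' i),
    measure_cylinder_eq_lintegral_directingKernel hp s ht']
  simp_rw [Measure.infinitePi_pi _ fun i _ => ht' i]
end

section
/- De Finetti Theorem (strong form): let X be a standard Borel space, let p be an exchangeable probability measure on ℕ → X, and let κ : (ℕ → X) → X be a regular conditional distribution (Markov kernel) of the coordinate x₀ given the shifted sequence (x_{k+1})_{k∈ℕ} under p (the tail conditional). Then for every n ∈ ℕ, the joint law under p of the random element ((x₀, …, x_{n−1}), (x_{n+k})_{k∈ℕ}) ∈ Xⁿ × (ℕ → X) equals the measure obtained by sampling t ∈ (ℕ → X) from p, then sampling the n components i.i.d. from κ(t), and outputting (the n samples, t). -/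
open MeasureTheory ProbabilityTheory
open scoped ProbabilityTheory

/-- A map that is injective on a finite set of natural numbers agrees there with a permutation
moving only finitely many elements. -/
theorem exists_perm_finite_support_eqOn (s : Finset ℕ) {τ : ℕ → ℕ} (hτ : Function.Injective τ) :
    ∃ σ : Equiv.Perm ℕ, {n | σ n ≠ n}.Finite ∧ ∀ i ∈ s, σ i = τ i := by
  classical
  let u : Finset ℕ := s ∪ s.image τ
  obtain ⟨g, hg⟩ := Set.MapsTo.exists_equiv_extend_of_card_eq (α := u) (t := u)
    (s := {i | (i : ℕ) ∈ s}) (f := fun i => τ i) (by simp)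
    (fun i hi => by
      simp only [u, Finset.coe_union, Finset.coe_image, Set.mem_union]
      exact Or.inr ⟨i, hi, rfl⟩)
    (fun i _ j _ h => Subtype.ext (hτ h))
  refine ⟨Equiv.Perm.ofSubtype (p := (· ∈ u)) g, u.finite_toSet.subset fun n hn => ?_,
    fun i hi => ?_⟩
  · by_contra h
    exact hn (Equiv.Perm.ofSubtype_apply_of_not_mem g h)
  · have hu : i ∈ u := Finset.mem_union_left _ hi
    rw [Equiv.Perm.ofSubtype_apply_of_mem (p := (· ∈ u)) g hu]
    exact hg ⟨i, hu⟩ hi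

/-- An exchangeable measure is invariant under reindexing along any injection. -/
theorem Exchangeable.map_comp_injective_s2 {X : Type*} [MeasurableSpace X] {p : Measure (ℕ → X)}
    [IsProbabilityMeasure p] (hp : Exchangeable p) {τ : ℕ → ℕ} (hτ : Function.Injective τ) :
    p.map (fun x => x ∘ τ) = p := by
  have hm (ρ : ℕ → ℕ) : Measurable fun x : ℕ → X => x ∘ ρ :=
    measurable_pi_lambda _ fun i => measurable_pi_apply (ρ i)
  refine IsProjectiveLimit.unique (P := fun s : Finset ℕ => p.map s.restrict) (fun s => ?_)
    fun _ => rfl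
  obtain ⟨σ, hσ, hs⟩ := exists_perm_finite_support_eqOn s hτ
  dsimp only
  rw [Measure.map_map (Finset.measurable_restrict s) (hm τ)]
  conv_rhs => rw [← hp σ hσ, Measure.map_map (Finset.measurable_restrict s) (hm σ)]
  congr 1
  ext x i
  simp [Finset.restrict, hs i i.2]

/-- Measurable functions bounded by one whose inner product equals both of their squared norms
agree almost everywhere. -/
theorem ae_eq_of_lintegral_mul_eq {Ω : Type*} [MeasurableSpace Ω] {μ : Measure Ω}
    [IsFiniteMeasure μ] {g h : Ω → ENNReal} (hg : Measurable g) (hh : Measurable h)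
    (hg1 : ∀ t, g t ≤ 1) (hh1 : ∀ t, h t ≤ 1)
    (hgh : ∫⁻ t, h t * g t ∂μ = ∫⁻ t, g t * g t ∂μ)
    (hhh : ∫⁻ t, h t * h t ∂μ = ∫⁻ t, g t * g t ∂μ) : g =ᵐ[μ] h := by
  have key {a b : Ω → ENNReal} (ha : Measurable a) (hb : Measurable b) (ha1 : ∀ t, a t ≤ 1)
      (hb1 : ∀ t, b t ≤ 1) : Integrable (fun t => (a t).toReal * (b t).toReal) μ ∧
        ∫ t, (a t).toReal * (b t).toReal ∂μ = (∫⁻ t, a t * b t ∂μ).toReal := by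
    have hab (t : Ω) : a t * b t ≤ 1 := mul_le_one' (ha1 t) (hb1 t)
    simp_rw [← ENNReal.toReal_mul]
    refine ⟨integrable_toReal_of_lintegral_ne_top (ha.mul hb).aemeasurable ?_,
      integral_toReal (ha.mul hb).aemeasurable
        (.of_forall fun t => (hab t).trans_lt ENNReal.one_lt_top)⟩
    refine ((lintegral_mono hab).trans_lt ?_).ne
    simp
  obtain ⟨i₁, e₁⟩ := key hg hg hg1 hg1
  obtain ⟨i₂, e₂⟩ := key hh hg hh1 hg1
  obtain ⟨i₃, e₃⟩ := key hh hh hh1 hh1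
  have hexp : (fun t => ((g t).toReal - (h t).toReal) ^ 2) = fun t =>
      ((g t).toReal * (g t).toReal - 2 * ((h t).toReal * (g t).toReal))
        + (h t).toReal * (h t).toReal := by
    funext t; ring
  have hmean : Integrable (fun t => ((g t).toReal - (h t).toReal) ^ 2) μ := by
    rw [hexp]; exact (i₁.sub (i₂.const_mul 2)).add i₃
  have hzero : ∫ t, ((g t).toReal - (h t).toReal) ^ 2 ∂μ = 0 := by
    have i₁₂ : Integrable
        (fun t => (g t).toReal * (g t).toReal - 2 * ((h t).toReal * (g t).toReal)) μ :=
      i₁.sub (i₂.const_mul 2)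
    rw [hexp, integral_add i₁₂ i₃, integral_sub i₁ (i₂.const_mul 2),
      integral_const_mul, e₁, e₂, e₃, hgh, hhh]
    ring
  filter_upwards [(integral_eq_zero_iff_of_nonneg (fun t => sq_nonneg _) hmean).1 hzero] with t ht
  have : (g t).toReal = (h t).toReal := by simpa [sub_eq_zero] using ht
  exact (ENNReal.toReal_eq_toReal_iff' ((hg1 t).trans_lt ENNReal.one_lt_top).ne
    ((hh1 t).trans_lt ENNReal.one_lt_top).ne).1 this

/-- Finite powers of a Markov kernel depend measurably on the parameter. -/
theorem measurable_measure_pi_kernel {T X ι : Type*} [MeasurableSpace T] [MeasurableSpace X]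
    [Fintype ι] (κ : Kernel T X) [IsMarkovKernel κ] :
    Measurable fun t => Measure.pi fun _ : ι => κ t := by
  refine .measure_of_isPiSystem_of_isProbabilityMeasure generateFrom_pi.symm isPiSystem_pi ?_
  rintro _ ⟨s, hs, rfl⟩
  simp_rw [Measure.pi_pi]
  exact Finset.measurable_prod _ fun i _ => κ.measurable_coe (hs i trivial)

/-- Integrating against i.i.d. samples drawn from a Markov kernel and the sampled parameter. -/
theorem lintegral_bind_pi_kernel {T X ι : Type*} [MeasurableSpace T] [MeasurableSpace X]
    [Fintype ι] (p : Measure T) (κ : Kernel T X) [IsMarkovKernel κ]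
    {F : (ι → X) × T → ENNReal} (hF : Measurable F) :
    ∫⁻ z, F z ∂(p.bind fun t => (Measure.pi fun _ : ι => κ t).map fun v => (v, t)) =
      ∫⁻ t, ∫⁻ v, F (v, t) ∂(Measure.pi fun _ : ι => κ t) ∂p := by
  let η : Kernel T (ι → X) := ⟨_, measurable_measure_pi_kernel κ⟩
  have : IsMarkovKernel η := ⟨fun t => by change IsProbabilityMeasure (Measure.pi _); infer_instance⟩
  have hη : Measurable fun t => (η t).map fun v => (v, t) := by
    refine Measure.measurable_of_measurable_coe _ fun s hs => ?_
    simp_rw [Measure.map_apply measurable_prodMk_right hs]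
    exact Kernel.measurable_kernel_prodMk_left (κ := η) (measurable_swap hs)
  refine (Measure.lintegral_bind hη.aemeasurable hF.aemeasurable).trans ?_
  exact lintegral_congr fun t => lintegral_map hF measurable_prodMk_right

section Shift

variable {X : Type*} [MeasurableSpace X] {p : Measure (ℕ → X)} {κ : Kernel (ℕ → X) X}

/-- Shifting a sequence is measurable. -/
theorem measurable_shift (n : ℕ) : Measurable fun (x : ℕ → X) k => x (n + k) :=
  measurable_pi_lambda _ fun k => measurable_pi_apply (n + k)

/-- An exchangeable measure is shift-invariant. -/
theorem Exchangeable.measurePreserving_shift [IsProbabilityMeasure p] (hp : Exchangeable p)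
    (n : ℕ) : MeasurePreserving (fun (x : ℕ → X) k => x (n + k)) p p :=
  ⟨measurable_shift n, hp.map_comp_injective_s2 (add_right_injective n)⟩

/-- Integration of a function of the tail and the head, for a shift-invariant measure with tail
conditional `κ`. -/
theorem lintegral_tail_head [SFinite p] [IsMarkovKernel κ]
    (hshift : p.map (fun x k => x (k + 1)) = p)
    (hκ : p.map (fun x => (fun k => x (k + 1), x 0)) =
      (p.map (fun x => fun k => x (k + 1))) ⊗ₘ κ)
    {F : (ℕ → X) × X → ENNReal} (hF : Measurable F) :
    ∫⁻ x, F (fun k => x (k + 1), x 0) ∂p = ∫⁻ t, ∫⁻ y, F (t, y) ∂κ t ∂p := by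
  rw [hshift] at hκ
  rw [← Measure.lintegral_compProd hF, ← hκ, lintegral_map hF (by fun_prop)]

/-- The tail conditional of an exchangeable measure is almost surely shift-invariant. -/
theorem Exchangeable.tail_conditional_ae_eq_shift [MeasurableSpace.CountablyGenerated X]
    [IsProbabilityMeasure p] [IsMarkovKernel κ] (hp : Exchangeable p)
    (hκ : p.map (fun x => (fun k => x (k + 1), x 0)) =
      (p.map (fun x => fun k => x (k + 1))) ⊗ₘ κ) :
    ∀ᵐ t ∂p, κ t = κ fun k => t (k + 1) := by
  have hm : Measurable fun (t : ℕ → X) k => t (k + 1) := by fun_prop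
  have hshift : p.map (fun x k => x (k + 1)) = p := hp.map_comp_injective_s2 (add_left_injective 1)
  have hpres : MeasurePreserving (fun (x : ℕ → X) k => x (k + 1)) p p := ⟨hm, hshift⟩
  have hset {A : Set X} (hA : MeasurableSet A) :
      (fun t => κ t A) =ᵐ[p] fun t => κ (fun k => t (k + 1)) A := by
    have hg : Measurable fun t => κ t A := κ.measurable_coe hA
    have hone : Measurable (A.indicator (1 : X → ENNReal)) := measurable_one.indicator hA
    have hmean {f : (ℕ → X) → ENNReal} (hf : Measurable f) :
        ∫⁻ x, f (fun k => x (k + 1)) * A.indicator 1 (x 0) ∂p = ∫⁻ t, f t * κ t A ∂p := by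
      rw [lintegral_tail_head hshift hκ (F := fun z => f z.1 * A.indicator 1 z.2) (by fun_prop)]
      refine lintegral_congr fun t => ?_
      dsimp only
      rw [lintegral_const_mul _ hone, lintegral_indicator_one hA]
    refine ae_eq_of_lintegral_mul_eq hg (hg.comp hm) (fun _ => prob_le_one)
      (fun _ => prob_le_one) ?_ (hpres.lintegral_comp (hg.mul hg))
    have hskip : MeasurePreserving (fun (x : ℕ → X) => x ∘ fun k => if k = 0 then 0 else k + 1)
        p p := by
      refine ⟨by fun_prop, hp.map_comp_injective_s2 fun i j hij => ?_⟩
      split_ifs at hij <;> omega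
    have hF : Measurable fun x : ℕ → X => κ (fun k => x (k + 1)) A * A.indicator 1 (x 0) :=
      (hg.comp hm).mul (hone.comp (measurable_pi_apply 0))
    exact (hmean (hg.comp hm)).symm.trans ((hskip.lintegral_comp hF).trans (hmean hg))
  refine Kernel.ae_eq_of_compProd_eq (η := κ.comap _ hm) (Measure.ext_prod fun {s A} hs hA => ?_)
  rw [Measure.compProd_apply_prod hs hA, Measure.compProd_apply_prod hs hA]
  exact lintegral_congr_ae (ae_restrict_of_ae (hset hA))

/-- The tail conditional of an exchangeable measure is almost surely invariant under iterated
shifts. -/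
theorem Exchangeable.tail_conditional_ae_eq_shift_add [MeasurableSpace.CountablyGenerated X]
    [IsProbabilityMeasure p] [IsMarkovKernel κ] (hp : Exchangeable p)
    (hκ : p.map (fun x => (fun k => x (k + 1), x 0)) =
      (p.map (fun x => fun k => x (k + 1))) ⊗ₘ κ) (n : ℕ) :
    ∀ᵐ t ∂p, κ t = κ fun k => t (n + k) := by
  induction n with
  | zero => simp
  | succ n ih =>
    filter_upwards [ih, (hp.measurePreserving_shift n).quasiMeasurePreserving.ae
      (hp.tail_conditional_ae_eq_shift hκ)] with t h₁ h₂
    rw [h₁, h₂]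
    congr 1
    funext k
    congr 1
    omega

end Shift

/-- **De Finetti Theorem (strong form)**: let `p` be an exchangeable probability measure on
`ℕ → X` (`X` standard Borel) and let `κ` be a regular conditional distribution of the
coordinate `x 0` given the shifted sequence `fun k => x (k + 1)` (the tail conditional),
i.e. the joint law of `(tail, head)` is the law of the tail composed with `κ`.  Then for
every `n`, the joint law under `p` of `((x 0, …, x (n-1)), fun k => x (n + k))` is obtained
by sampling `t` from `p`, sampling the `n` components i.i.d. from `κ t`, and outputting
`(samples, t)`. -/
theorem deFinetti_strong {X : Type*} [MeasurableSpace X] [StandardBorelSpace X]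
    (p : Measure (ℕ → X)) [IsProbabilityMeasure p] (hp : Exchangeable p)
    (κ : Kernel (ℕ → X) X) [IsMarkovKernel κ]
    (hκ : p.map (fun x => (fun k => x (k + 1), x 0)) =
      (p.map (fun x => fun k => x (k + 1))) ⊗ₘ κ) :
    ∀ n : ℕ,
      p.map (fun x => ((fun i : Fin n => x i), fun k => x (n + k))) =
        p.bind (fun t => (Measure.pi fun _ : Fin n => κ t).map (fun v => (v, t))) := by
  have hshift : p.map (fun x k => x (k + 1)) = p := hp.map_comp_injective_s2 (add_left_injective 1)
  intro n
  refine Measure.ext_of_lintegral _ fun F hF => ?_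
  rw [lintegral_map hF (by fun_prop), lintegral_bind_pi_kernel p κ hF]
  induction n with
  | zero =>
    refine lintegral_congr fun t => ?_
    rw [Measure.pi_of_empty _ fun i : Fin 0 => t i, lintegral_dirac]
    simp
  | succ n ih =>
    let e := (MeasurableEquiv.piFinSuccAbove (fun _ : Fin (n + 1) => X) 0).symm
    let η : Kernel (ℕ → X) (Fin n → X) := ⟨_, measurable_measure_pi_kernel κ⟩
    let G : (ℕ → X) × X → ENNReal :=
      fun z => F (e (z.2, fun i => z.1 i), fun k => z.1 (n + k))
    let H : (Fin n → X) × (ℕ → X) → ENNReal := fun z => ∫⁻ y, F (e (y, z.1), z.2) ∂κ z.2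
    have hG : Measurable G := by fun_prop
    have hH : Measurable H :=
      Measurable.lintegral_kernel_prod_right (κ := κ.comap Prod.snd measurable_snd)
        (f := fun z y => F (e (y, z.1), z.2)) (by unfold Function.uncurry; fun_prop)
    calc ∫⁻ x, F (fun i : Fin (n + 1) => x i, fun k => x (n + 1 + k)) ∂p
        = ∫⁻ x, G (fun k => x (k + 1), x 0) ∂p := by
          refine lintegral_congr fun x => congrArg F (Prod.ext ?_ ?_)
          · funext i
            refine Fin.cases ?_ (fun j => ?_) i <;> simp [e]
          · funext k
            exact congrArg x (by omega)
      _ = ∫⁻ t, ∫⁻ y, G (t, y) ∂κ t ∂p := lintegral_tail_head hshift hκ hG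
      _ = ∫⁻ t, H (fun i : Fin n => t i, fun k => t (n + k)) ∂p := by
          refine lintegral_congr_ae ?_
          filter_upwards [hp.tail_conditional_ae_eq_shift_add hκ n] with t ht
          simp only [G, H]
          rw [ht]
      _ = ∫⁻ t, ∫⁻ v, H (v, t) ∂(Measure.pi fun _ : Fin n => κ t) ∂p := ih H hH
      _ = _ := by
          refine lintegral_congr fun t => ?_
          have hpi := (measurePreserving_piFinSuccAbove (fun _ : Fin (n + 1) => κ t) 0).symm
          have hFt : Measurable fun v : Fin (n + 1) → X => F (v, t) := by fun_prop
          rw [← hpi.lintegral_comp hFt, lintegral_prod_symm' _ (by fun_prop)]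
end

section
/- Permutation invariance is equivalent to shift invariance: let A, X, Y be standard Borel spaces, let p : A → (ℕ → X) be an exchangeable Markov kernel, and let f : (ℕ → X) → Y be a Markov kernel. Then the following are equivalent: (i) for every permutation σ of ℕ fixing all but finitely many elements and every a ∈ A, f(x ∘ σ) = f(x) (as probability measures on Y) for p(a)-almost every x; (ii) for every a ∈ A, f(x ∘ succ) = f(x) for p(a)-almost every x, where x ∘ succ denotes the shifted sequence (x_{k+1})_{k∈ℕ}. -/
open MeasureTheory ProbabilityTheory

/-- A Markov kernel `p : A → (ℕ → X)` is exchangeable if for every permutation `σ` of `ℕ`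
fixing all but finitely many elements and every `a`, the pushforward of `p a` under
`x ↦ x ∘ σ` equals `p a`. -/
def ExchangeableKernel {A X : Type*} [MeasurableSpace A] [MeasurableSpace X]
    (p : Kernel A (ℕ → X)) : Prop :=
  ∀ σ : Equiv.Perm ℕ, {n | σ n ≠ n}.Finite → ∀ a, (p a).map (fun x => x ∘ σ) = p a

open Filter Topology

/-- The finite cycle `0 ↦ 1 ↦ ⋯ ↦ n ↦ 0`, which agrees with the successor map below `n`. -/
def initialCycle (n : ℕ) : Equiv.Perm ℕ where
  toFun k := if k < n then k + 1 else if k = n then 0 else k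
  invFun k := if k = 0 then n else if k ≤ n then k - 1 else k
  left_inv k := by grind
  right_inv k := by grind

lemma initialCycle_of_lt {n k : ℕ} (hk : k < n) : initialCycle n k = k + 1 := if_pos hk

lemma finite_support_initialCycle (n : ℕ) : {k | initialCycle n k ≠ k}.Finite := by
  refine (Set.finite_Iic n).subset fun k hk => ?_
  by_contra h
  simp only [Set.mem_Iic, not_le] at h
  exact hk (by simp [initialCycle, h.not_gt, h.ne'])

section Sequences

variable {X : Type*} [MeasurableSpace X] {μ : Measure (ℕ → X)}

lemma measurable_comp_right {ι κ : Type*} (e : ι → κ) :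
    Measurable (fun (x : κ → X) => x ∘ e) :=
  measurable_pi_lambda _ fun _ => measurable_pi_apply _

/-- Measures on sequences invariant under finite permutations are shift invariant. -/
lemma measurePreserving_shift_of_exchangeable [IsFiniteMeasure μ]
    (hμ : ∀ σ : Equiv.Perm ℕ, {n | σ n ≠ n}.Finite → μ.map (fun x => x ∘ σ) = μ) :
    MeasurePreserving (fun (x : ℕ → X) k => x (k + 1)) μ μ := by
  have hS : Measurable (fun (x : ℕ → X) k => x (k + 1)) := measurable_comp_right Nat.succ
  refine ⟨hS, IsProjectiveLimit.unique (P := fun I => μ.map I.restrict) (fun I => ?_)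
    fun _ => rfl⟩
  obtain ⟨n, hn⟩ : ∃ n, ∀ k ∈ I, k < n :=
    ⟨I.sup id + 1, fun k hk => Nat.lt_succ_of_le (Finset.le_sup (f := id) hk)⟩
  have hrestrict : I.restrict ∘ (fun (x : ℕ → X) k => x (k + 1))
      = I.restrict ∘ (fun x : ℕ → X => x ∘ initialCycle n) := by
    ext x k
    simp [Finset.restrict, initialCycle_of_lt (hn k k.2)]
  rw [Measure.map_map (Finset.measurable_restrict I) hS, hrestrict,
    ← Measure.map_map (Finset.measurable_restrict I) (measurable_comp_right _),
    hμ _ (finite_support_initialCycle n)]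

lemma iSup_piLE_eq_pi : ⨆ n, Filtration.piLE (X := fun _ : ℕ => X) n = MeasurableSpace.pi := by
  refine le_antisymm (iSup_le fun n => Filtration.piLE.le n) (iSup_le fun n => ?_)
  refine le_trans ?_ (le_iSup (fun n => Filtration.piLE (X := fun _ : ℕ => X) n) n)
  rw [Filtration.piLE_eq_comap_frestrictLe, ← measurable_iff_comap_le]
  exact (measurable_pi_apply (X := fun _ : Finset.Iic n => X) ⟨n, by simp⟩).comp
    (comap_measurable _)

/-- An integrable function of an exchangeable sequence that is a.e. invariant under finite
permutations is a.e. shift invariant. -/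
lemma ae_shift_eq_of_ae_perm_eq [IsProbabilityMeasure μ]
    (hμ : ∀ σ : Equiv.Perm ℕ, {n | σ n ≠ n}.Finite → μ.map (fun x => x ∘ σ) = μ)
    {g : (ℕ → X) → ℝ} (hg : Measurable g) (hgi : Integrable g μ)
    (hinv : ∀ σ : Equiv.Perm ℕ, {n | σ n ≠ n}.Finite → ∀ᵐ x ∂μ, g (x ∘ σ) = g x) :
    ∀ᵐ x ∂μ, g (fun k => x (k + 1)) = g x := by
  have hS := measurePreserving_shift_of_exchangeable hμ
  set S : (ℕ → X) → (ℕ → X) := fun x k => x (k + 1)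
  set h : ℕ → (ℕ → X) → ℝ := fun n => μ[g | Filtration.piLE (X := fun _ : ℕ => X) n]
  have hh (n : ℕ) : AEStronglyMeasurable (h n - g) μ :=
    (integrable_condExp.sub hgi).aestronglyMeasurable
  have hlim : Tendsto (fun n => eLpNorm (h n - g) 1 μ) atTop (𝓝 0) :=
    hgi.tendsto_eLpNorm_condExp (by rw [iSup_piLE_eq_pi]; exact hg.stronglyMeasurable)
  have hbound (n : ℕ) :
      eLpNorm (g ∘ S - g) 1 μ ≤ eLpNorm (h n - g) 1 μ + eLpNorm (h n - g) 1 μ := by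
    set τ : (ℕ → X) → (ℕ → X) := fun x => x ∘ initialCycle (n + 1)
    have hτ : MeasurePreserving τ μ μ :=
      ⟨measurable_comp_right _, hμ _ (finite_support_initialCycle _)⟩
    have hdep : DependsOn (h n) (Set.Iic n) :=
      (stronglyMeasurable_condExp (m := Filtration.piLE (X := fun _ : ℕ => X) n)).dependsOn_of_piLE
    have heq : g ∘ S - g =ᵐ[μ] (h n - g) ∘ τ - (h n - g) ∘ S := by
      filter_upwards [hinv _ (finite_support_initialCycle (n + 1))] with x hx
      have hSτ : h n (S x) = h n (τ x) := hdep fun k hk => by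
        simp [S, τ, initialCycle_of_lt (Nat.lt_succ_of_le hk)]
      have hx' : g (τ x) = g x := hx
      simp only [Pi.sub_apply, Function.comp_apply, hSτ, hx']
      ring
    rw [eLpNorm_congr_ae heq]
    refine (eLpNorm_sub_le ((hh n).comp_measurePreserving hτ)
      ((hh n).comp_measurePreserving hS) le_rfl).trans_eq ?_
    rw [eLpNorm_comp_measurePreserving (hh n) hτ, eLpNorm_comp_measurePreserving (hh n) hS]
  have hzero : eLpNorm (g ∘ S - g) 1 μ = 0 :=
    le_antisymm (ge_of_tendsto' (by simpa using hlim.add hlim) hbound) zero_le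
  rw [eLpNorm_eq_zero_iff ((hg.comp hS.measurable).sub hg).aestronglyMeasurable one_ne_zero]
    at hzero
  filter_upwards [hzero] with x hx
  exact sub_eq_zero.1 hx

/-- A function on sequences that is a.e. invariant under the measure-preserving shift is a.e.
invariant under measure-preserving finite permutations. -/
lemma ae_perm_eq_of_ae_shift_eq {β : Type*} {f : (ℕ → X) → β} {σ : Equiv.Perm ℕ}
    (hS : MeasurePreserving (fun (x : ℕ → X) k => x (k + 1)) μ μ)
    (hσ : MeasurePreserving (fun x : ℕ → X => x ∘ σ) μ μ) (hfin : {n | σ n ≠ n}.Finite)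
    (hinv : ∀ᵐ x ∂μ, f (fun k => x (k + 1)) = f x) :
    ∀ᵐ x ∂μ, f (x ∘ σ) = f x := by
  have hiter (n : ℕ) : ∀ᵐ x ∂μ, f (fun k => x (k + n)) = f x := by
    induction n with
    | zero => simp
    | succ n ih =>
      filter_upwards [hS.quasiMeasurePreserving.ae ih, hinv] with x h₁ h₂
      rw [← h₂, ← h₁]
      congr! 3
  obtain ⟨n, hn⟩ : ∃ n, ∀ k, n ≤ k → σ k = k := by
    obtain ⟨m, hm⟩ := hfin.bddAbove
    refine ⟨m + 1, fun k hk => ?_⟩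
    by_contra hne
    exact absurd (hm hne) (by omega)
  filter_upwards [hσ.quasiMeasurePreserving.ae (hiter n), hiter n] with x h₁ h₂
  rw [← h₁, ← h₂]
  simp [hn]

end Sequences

/-- Probability measures on a standard Borel space agree as soon as they agree on the
preimages of the rational half-lines under an embedding into `ℝ`. -/
lemma measure_eq_of_embeddingReal_Iic_rat {Y : Type*} [MeasurableSpace Y] [StandardBorelSpace Y]
    {μ ν : Measure Y} [IsProbabilityMeasure μ] [IsProbabilityMeasure ν]
    (h : ∀ q : ℚ, μ.real (embeddingReal Y ⁻¹' Set.Iic (q : ℝ))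
      = ν.real (embeddingReal Y ⁻¹' Set.Iic (q : ℝ))) : μ = ν := by
  have he := measurableEmbedding_embeddingReal Y
  have := Measure.isProbabilityMeasure_map (μ := μ) he.measurable.aemeasurable
  have := Measure.isProbabilityMeasure_map (μ := ν) he.measurable.aemeasurable
  refine he.map_injective (ext_of_generate_finite _
    ((BorelSpace.measurable_eq (α := ℝ)).trans Real.borel_eq_generateFrom_Iic_rat)
    Real.isPiSystem_Iic_rat (fun s hs => ?_) (by simp))
  obtain ⟨q, rfl⟩ := Set.mem_iUnion.1 hs
  rw [he.map_apply, he.map_apply]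
  exact (measureReal_eq_measureReal_iff).1 (h q)

/-- **Permutation invariance is equivalent to shift invariance**: for an exchangeable
Markov kernel `p : A → (ℕ → X)` and a Markov kernel `f : (ℕ → X) → Y` (all spaces standard
Borel), `f` is `p`-a.s. invariant under all finite permutations iff it is `p`-a.s.
invariant under the shift. -/
theorem perm_invariance_iff_shift_invariance
    {A X Y : Type*} [MeasurableSpace A] [MeasurableSpace X] [MeasurableSpace Y]
    [StandardBorelSpace A] [StandardBorelSpace X] [StandardBorelSpace Y]
    (p : Kernel A (ℕ → X)) [IsMarkovKernel p] (hp : ExchangeableKernel p)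
    (f : Kernel (ℕ → X) Y) [IsMarkovKernel f] :
    (∀ σ : Equiv.Perm ℕ, {n | σ n ≠ n}.Finite →
        ∀ a, ∀ᵐ x ∂(p a), f (x ∘ σ) = f x) ↔
      (∀ a, ∀ᵐ x ∂(p a), f (fun k => x (k + 1)) = f x) := by
  have hμ (a : A) (σ : Equiv.Perm ℕ) (hσ : {n | σ n ≠ n}.Finite) :
      (p a).map (fun x => x ∘ σ) = p a := hp σ hσ a
  refine ⟨fun hinv a => ?_, fun hinv σ hσ a => ae_perm_eq_of_ae_shift_eq
    (measurePreserving_shift_of_exchangeable (hμ a)) ⟨measurable_comp_right _, hμ a σ hσ⟩ hσ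
    (hinv a)⟩
  have hq (q : ℚ) : ∀ᵐ x ∂(p a),
      (f fun k => x (k + 1)).real (embeddingReal Y ⁻¹' Set.Iic (q : ℝ))
        = (f x).real (embeddingReal Y ⁻¹' Set.Iic (q : ℝ)) := by
    have hmeas : Measurable fun x => (f x).real (embeddingReal Y ⁻¹' Set.Iic (q : ℝ)) :=
      (f.measurable_coe (measurableEmbedding_embeddingReal Y |>.measurable
        measurableSet_Iic)).ennreal_toReal
    refine ae_shift_eq_of_ae_perm_eq (hμ a) hmeas ?_ fun σ hσ => ?_
    · exact Integrable.of_bound hmeas.aestronglyMeasurable 1 (ae_of_all _ fun x => by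
        simp [abs_of_nonneg, measureReal_le_one])
    · filter_upwards [hinv σ hσ a] with x hx
      rw [hx]
  filter_upwards [ae_all_iff.2 hq] with x hx
  exact measure_eq_of_embeddingReal_Iic_rat hx
end

section
/- Single entry independence II: let X be a standard Borel space, let p be a row-column exchangeable probability measure on ℕ × ℕ → X, and fix n ∈ ℕ with 𝒜 = {0,…,n−1}. Then for all i, j ∈ 𝒜, under p the σ-algebra ℱ_{{(i,j)}} and the σ-algebra ℱ_{((𝒜∖{i}) × 𝒜ᶜ) ∪ (𝒜ᶜ × (𝒜∖{j}))} are conditionally independent given the σ-algebra ℱ_{(𝒜ᶜ × {j}) ∪ ({i} × 𝒜ᶜ) ∪ (𝒜ᶜ × 𝒜ᶜ)}. -/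
open MeasureTheory ProbabilityTheory

/-- A measure on `ℕ × ℕ → X` is row-column exchangeable if for every permutation `σ` of `ℕ`
fixing all but finitely many elements, it is invariant under permuting the rows by `σ` and
under permuting the columns by `σ`. -/
def RowColumnExchangeable {X : Type*} [MeasurableSpace X]
    (p : Measure (ℕ × ℕ → X)) : Prop :=
  ∀ σ : Equiv.Perm ℕ, {n | σ n ≠ n}.Finite →
    p.map (fun x (ij : ℕ × ℕ) => x (σ ij.1, ij.2)) = p ∧
    p.map (fun x (ij : ℕ × ℕ) => x (ij.1, σ ij.2)) = p

/-- The sub-σ-algebra `ℱ_S` of `ℕ × ℕ → X` generated by the coordinate projections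
`x ↦ x (i, j)` for `(i, j) ∈ S`. -/
def coordSigma (X : Type*) [mX : MeasurableSpace X] (S : Set (ℕ × ℕ)) :
    MeasurableSpace (ℕ × ℕ → X) :=
  ⨆ ij ∈ S, mX.comap (fun x => x ij)

lemma coordSigma_le (X : Type*) [MeasurableSpace X] (S : Set (ℕ × ℕ)) :
    coordSigma X S ≤ MeasurableSpace.pi :=
  iSup₂_le fun ij _ => (measurable_pi_apply ij).comap_le

/-- The set `𝒜 = {0, …, n-1} ⊆ ℕ`. -/
def blk (n : ℕ) : Set ℕ := {k | k < n}

/-- Conditional expectation commutes with composition by a measure-preserving map. -/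
lemma condExp_comp_measurePreserving {α β : Type*} {m : MeasurableSpace β}
    [mα : MeasurableSpace α] [mβ : MeasurableSpace β] {μ : Measure α} {ν : Measure β} [IsFiniteMeasure μ]
    [IsFiniteMeasure ν] {T : α → β} (hT : MeasurePreserving T μ ν)
    (hm : m ≤ mβ) {f : β → ℝ} (hf : Integrable f ν) :
    (ν[f | m]) ∘ T =ᵐ[μ] μ[f ∘ T | m.comap T] := by
  have hle : m.comap T ≤ mα := (MeasurableSpace.comap_mono hm).trans hT.measurable.comap_le
  have hset {g : β → ℝ} (hg : Integrable g ν) {s : Set β} (hs : MeasurableSet[m] s) :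
      ∫ x in T ⁻¹' s, (g ∘ T) x ∂μ = ∫ y in s, g y ∂ν := by
    have h := setIntegral_map (hm s hs) (hT.map_eq.symm ▸ hg.aestronglyMeasurable)
      hT.measurable.aemeasurable
    rw [hT.map_eq] at h
    exact h.symm
  refine ae_eq_condExp_of_forall_setIntegral_eq hle (hT.integrable_comp_of_integrable hf)
    (fun _ _ _ => (hT.integrable_comp_of_integrable integrable_condExp).integrableOn) ?_ ?_
  · rintro _ ⟨s, hs, rfl⟩ -
    rw [hset integrable_condExp hs, hset hf hs, setIntegral_condExp hm hf hs]
  · have hmeas : Measurable[m.comap T, m] T := Measurable.of_comap_le le_rfl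
    exact (stronglyMeasurable_condExp.comp_measurable hmeas).aestronglyMeasurable

/-- Conditional expectations of a square-integrable function given nested σ-algebras agree
as soon as they have the same second moment. -/
lemma condExp_ae_eq_of_integral_sq_eq {α : Type*} {m₁ m₂ : MeasurableSpace α}
    [mα : MeasurableSpace α] {μ : Measure α} [IsFiniteMeasure μ] (h₁₂ : m₁ ≤ m₂) (h₂ : m₂ ≤ mα)
    {f : α → ℝ} (hf : MemLp f 2 μ)
    (hsq : ∫ x, (μ[f | m₁]) x ^ 2 ∂μ = ∫ x, (μ[f | m₂]) x ^ 2 ∂μ) :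
    μ[f | m₁] =ᵐ[μ] μ[f | m₂] := by
  have hg₁ : MemLp (μ[f | m₁]) 2 μ := hf.condExp one_le_two
  have hg₂ : MemLp (μ[f | m₂]) 2 μ := hf.condExp one_le_two
  have hmul : Integrable (μ[f | m₁] * μ[f | m₂]) μ := hg₁.integrable_mul hg₂
  have hcross : ∫ x, (μ[f | m₁] * μ[f | m₂]) x ∂μ = ∫ x, (μ[f | m₁]) x ^ 2 ∂μ := by
    rw [← integral_condExp (h₁₂.trans h₂)]
    refine integral_congr_ae ?_
    filter_upwards [condExp_mul_of_stronglyMeasurable_left stronglyMeasurable_condExp hmul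
      integrable_condExp, condExp_condExp_of_le (μ := μ) (f := f) h₁₂ h₂] with x hx hx'
    rw [hx, Pi.mul_apply, hx', sq]
  have hzero : ∫ x, ((μ[f | m₁]) x - (μ[f | m₂]) x) ^ 2 ∂μ = 0 := by
    have hexp : ∀ x, ((μ[f | m₁]) x - (μ[f | m₂]) x) ^ 2 =
        (μ[f | m₁]) x ^ 2 - 2 * (μ[f | m₁] * μ[f | m₂]) x + (μ[f | m₂]) x ^ 2 := fun x => by
      rw [Pi.mul_apply]; ring
    simp_rw [hexp]
    have hsub : Integrable
        (fun x => (μ[f | m₁]) x ^ 2 - 2 * (μ[f | m₁] * μ[f | m₂]) x) μ :=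
      hg₁.integrable_sq.sub (hmul.const_mul 2)
    rw [integral_add hsub hg₂.integrable_sq, integral_sub hg₁.integrable_sq (hmul.const_mul 2), integral_const_mul, hcross, ← hsq]
    ring
  have hae := (integral_eq_zero_iff_of_nonneg (fun x => sq_nonneg _)
    (hg₁.sub hg₂).integrable_sq).mp hzero
  filter_upwards [hae] with x hx
  simpa [sub_eq_zero] using hx

/-- If a function is invariant under a measure-preserving map `T`, its conditional expectation
does not change when `m` is replaced by any σ-algebra between `T⁻¹ m` and `m`. -/
lemma condExp_ae_eq_of_comp_measurePreserving {α : Type*} {m' m : MeasurableSpace α}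
    [mα : MeasurableSpace α] {μ : Measure α} [IsFiniteMeasure μ] {T : α → α}
    (hT : MeasurePreserving T μ μ) (hTm : m.comap T ≤ m') (hm' : m' ≤ m) (hm : m ≤ mα)
    {f : α → ℝ} (hf : MemLp f 2 μ) (hfT : f ∘ T = f) :
    μ[f | m'] =ᵐ[μ] μ[f | m] := by
  have hint : Integrable f μ := hf.integrable one_le_two
  have hcomp := condExp_comp_measurePreserving hT hm hint
  rw [hfT] at hcomp
  have heq : μ[f | m.comap T] =ᵐ[μ] μ[f | m] := by
    refine condExp_ae_eq_of_integral_sq_eq (hTm.trans hm') hm hf ?_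
    have hsm : AEStronglyMeasurable (fun x => (μ[f | m]) x ^ 2) (μ.map T) := by
      rw [hT.map_eq]
      exact integrable_condExp.aestronglyMeasurable.pow 2
    have hmap := integral_map hT.measurable.aemeasurable hsm
    rw [hT.map_eq] at hmap
    rw [hmap]
    refine integral_congr_ae ?_
    filter_upwards [hcomp] with x hx
    rw [← hx, Function.comp_apply]
  have hself : μ[μ[f | m.comap T] | m'] = μ[f | m.comap T] :=
    condExp_of_stronglyMeasurable (hm'.trans hm) (stronglyMeasurable_condExp.mono hTm)
      integrable_condExp
  calc μ[f | m'] =ᵐ[μ] μ[μ[f | m] | m'] := (condExp_condExp_of_le hm' hm).symm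
    _ =ᵐ[μ] μ[μ[f | m.comap T] | m'] := condExp_congr_ae heq.symm
    _ = μ[f | m.comap T] := hself
    _ =ᵐ[μ] μ[f | m] := heq

/-- If conditioning the events of `m₁` on `m` or on the smaller `m'` gives the same result,
then `m₁` is conditionally independent given `m'` of every sub-σ-algebra of `m`. -/
lemma condIndep_of_condExp_ae_eq {Ω : Type*} {mΩ : MeasurableSpace Ω} [StandardBorelSpace Ω]
    {μ : Measure Ω} [IsFiniteMeasure μ] {m' m m₁ m₂ : MeasurableSpace Ω} (hm' : m' ≤ mΩ)
    (hle : m' ≤ m) (hm : m ≤ mΩ) (hm₁ : m₁ ≤ mΩ) (hm₂ : m₂ ≤ m)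
    (h : ∀ s, MeasurableSet[m₁] s → μ⟦s | m'⟧ =ᵐ[μ] μ⟦s | m⟧) :
    CondIndep m' m₁ m₂ hm' μ := by
  rw [condIndep_iff m' m₁ m₂ hm' hm₁ (hm₂.trans hm)]
  intro s t hs ht
  have hsI : Integrable (s.indicator fun _ => (1 : ℝ)) μ :=
    (integrable_const 1).indicator (hm₁ s hs)
  have htI : Integrable (t.indicator fun _ => (1 : ℝ)) μ :=
    (integrable_const 1).indicator (hm t (hm₂ t ht))
  have hmul (g : Ω → ℝ) :
      g * (t.indicator fun _ => (1 : ℝ)) = t.indicator g := by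
    ext x
    by_cases hx : x ∈ t <;> simp [hx]
  have hst : ((s ∩ t).indicator fun _ => (1 : ℝ)) =
      (s.indicator fun _ => (1 : ℝ)) * t.indicator fun _ => (1 : ℝ) := by
    rw [hmul, Set.inter_comm, Set.indicator_indicator]
  have htm : StronglyMeasurable[m] (t.indicator fun _ => (1 : ℝ)) :=
    stronglyMeasurable_const.indicator (hm₂ t ht)
  calc μ⟦s ∩ t | m'⟧
      =ᵐ[μ] μ[μ⟦s ∩ t | m⟧ | m'] := (condExp_condExp_of_le hle hm).symm
    _ =ᵐ[μ] μ[μ⟦s | m⟧ * (t.indicator fun _ => (1 : ℝ)) | m'] := by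
        refine condExp_congr_ae ?_
        rw [hst]
        refine condExp_mul_of_stronglyMeasurable_right htm ?_ hsI
        rw [hmul]
        exact hsI.indicator (hm t (hm₂ t ht))
    _ =ᵐ[μ] μ[μ⟦s | m'⟧ * (t.indicator fun _ => (1 : ℝ)) | m'] :=
        condExp_congr_ae ((h s hs).symm.mul (ae_eq_refl _))
    _ =ᵐ[μ] μ⟦s | m'⟧ * μ⟦t | m'⟧ := by
        refine condExp_mul_of_stronglyMeasurable_left stronglyMeasurable_condExp ?_ htI
        rw [hmul]
        exact integrable_condExp.indicator (hm t (hm₂ t ht))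

/-- An injection agrees on any finite set with a finitely supported permutation. -/
lemma exists_perm_finite_eqOn {α : Type*} [DecidableEq α] {φ : α → α}
    (hφ : Function.Injective φ) (s : Finset α) :
    ∃ σ : Equiv.Perm α, {a | σ a ≠ a}.Finite ∧ ∀ a ∈ s, σ a = φ a := by
  induction s using Finset.induction_on with
  | empty => exact ⟨1, by simp, by simp⟩
  | insert a s ha ih =>
    obtain ⟨σ, hσ, hσs⟩ := ih
    refine ⟨Equiv.swap (σ a) (φ a) * σ,
      (hσ.union (Set.toFinite {σ a, φ a})).subset fun b hb => ?_, fun b hb => ?_⟩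
    · by_contra hb'
      simp only [Set.mem_union, Set.mem_ofPred_eq, Set.mem_insert_iff, Set.mem_singleton_iff,
        not_or, not_not] at hb'
      refine hb ?_
      rw [Equiv.Perm.mul_apply, hb'.1, Equiv.swap_apply_of_ne_of_ne hb'.2.1 hb'.2.2]
    · rcases Finset.mem_insert.mp hb with rfl | hb
      · simp
      · have hne : b ≠ a := fun h => ha (h ▸ hb)
        rw [Equiv.Perm.mul_apply, Equiv.swap_apply_of_ne_of_ne (σ.injective.ne hne)
          (by rw [hσs b hb]; exact hφ.ne hne), hσs b hb]

/-- A row-column exchangeable probability measure is invariant under reindexing the rows and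
the columns by arbitrary injections. -/
lemma RowColumnExchangeable.measurePreserving {X : Type*} [MeasurableSpace X]
    {p : Measure (ℕ × ℕ → X)} [IsProbabilityMeasure p] (hp : RowColumnExchangeable p)
    {φ ψ : ℕ → ℕ} (hφ : Function.Injective φ) (hψ : Function.Injective ψ) :
    MeasurePreserving (fun x (ij : ℕ × ℕ) => x (φ ij.1, ψ ij.2)) p p := by
  have hmeas (φ ψ : ℕ → ℕ) :
      Measurable fun (x : ℕ × ℕ → X) (ij : ℕ × ℕ) => x (φ ij.1, ψ ij.2) :=
    measurable_pi_lambda _ fun _ => measurable_pi_apply _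
  refine ⟨hmeas φ ψ, ?_⟩
  have hproj : IsProjectiveLimit p fun I : Finset (ℕ × ℕ) => p.map I.restrict := fun _ => rfl
  have (I : Finset (ℕ × ℕ)) : IsFiniteMeasure (p.map (I.restrict (π := fun _ => X))) :=
    inferInstance
  refine IsProjectiveLimit.unique (P := fun I : Finset (ℕ × ℕ) => p.map I.restrict)
    (fun I => ?_) hproj
  obtain ⟨σ, hσ, hσI⟩ := exists_perm_finite_eqOn hφ (I.image Prod.fst)
  obtain ⟨τ, hτ, hτI⟩ := exists_perm_finite_eqOn hψ (I.image Prod.snd)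
  have hστ : p.map (fun x (ij : ℕ × ℕ) => x (σ ij.1, τ ij.2)) = p := by
    conv_rhs => rw [← (hp σ hσ).1, ← (hp τ hτ).2]
    exact (Measure.map_map (hmeas σ id) (hmeas id τ)).symm
  change _ = p.map I.restrict
  conv_rhs => rw [← hστ]
  rw [Measure.map_map (Finset.measurable_restrict I) (hmeas φ ψ),
    Measure.map_map (Finset.measurable_restrict I) (hmeas σ τ)]
  congr 1
  ext x ⟨ij, hij⟩
  simp [hσI _ (Finset.mem_image_of_mem Prod.fst hij),
    hτI _ (Finset.mem_image_of_mem Prod.snd hij)]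

lemma coordSigma_mono (X : Type*) [MeasurableSpace X] {S T : Set (ℕ × ℕ)} (h : S ⊆ T) :
    coordSigma X S ≤ coordSigma X T :=
  biSup_mono h

lemma coordSigma_singleton (X : Type*) [mX : MeasurableSpace X] (ij : ℕ × ℕ) :
    coordSigma X {ij} = mX.comap fun x => x ij := by
  simp [coordSigma]

lemma comap_coordSigma_le {X : Type*} [mX : MeasurableSpace X] {S T : Set (ℕ × ℕ)}
    {g : ℕ × ℕ → ℕ × ℕ} (h : Set.MapsTo g S T) :
    (coordSigma X S).comap (fun x ij => x (g ij)) ≤ coordSigma X T := by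
  simp only [coordSigma, MeasurableSpace.comap_iSup, MeasurableSpace.comap_comp]
  exact iSup₂_le fun ij hij =>
    le_iSup₂_of_le (f := fun kl (_ : kl ∈ T) => mX.comap fun x : ℕ × ℕ → X => x kl)
      (g ij) (h hij) le_rfl

/-- The map fixing `i` and shifting every other natural number by `n`. -/
def shiftExcept (n i k : ℕ) : ℕ := if k = i then i else k + n

lemma shiftExcept_self (n i : ℕ) : shiftExcept n i i = i := if_pos rfl

lemma shiftExcept_mem_compl_blk {n i k : ℕ} (hk : k ≠ i) : shiftExcept n i k ∈ (blk n)ᶜ := by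
  simp [shiftExcept, hk, blk]

lemma shiftExcept_injective {n i : ℕ} (hi : i ∈ blk n) :
    Function.Injective (shiftExcept n i) := by
  intro a b hab
  have hi' : i < n := hi
  unfold shiftExcept at hab
  split_ifs at hab <;> omega

/-- **Single entry independence II**: let `p` be a row-column exchangeable probability
measure on `ℕ × ℕ → X` (`X` standard Borel) and `𝒜 = {0,…,n-1}`.  Then for all
`i, j ∈ 𝒜`, the σ-algebra generated by the coordinate `(i, j)` and the σ-algebra
`ℱ_{((𝒜∖{i}) × 𝒜ᶜ) ∪ (𝒜ᶜ × (𝒜∖{j}))}` are conditionally independent given the σ-algebra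
`ℱ_{(𝒜ᶜ × {j}) ∪ ({i} × 𝒜ᶜ) ∪ (𝒜ᶜ × 𝒜ᶜ)}`. -/
theorem single_entry_independence_II
    {X : Type*} [MeasurableSpace X] [StandardBorelSpace X]
    (p : Measure (ℕ × ℕ → X)) [IsProbabilityMeasure p]
    (hp : RowColumnExchangeable p) (n : ℕ) (i j : ℕ) (hi : i ∈ blk n) (hj : j ∈ blk n) :
    CondIndep
      (coordSigma X (((blk n)ᶜ ×ˢ {j}) ∪ ({i} ×ˢ (blk n)ᶜ) ∪ ((blk n)ᶜ ×ˢ (blk n)ᶜ)))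
      (coordSigma X {(i, j)})
      (coordSigma X (((blk n \ {i}) ×ˢ (blk n)ᶜ) ∪ ((blk n)ᶜ ×ˢ (blk n \ {j}))))
      (coordSigma_le X _) p := by
  set C := ((blk n)ᶜ ×ˢ {j}) ∪ ({i} ×ˢ (blk n)ᶜ) ∪ ((blk n)ᶜ ×ˢ (blk n)ᶜ)
  have hCD : C ⊆ {(i, j)}ᶜ := by
    rintro ⟨k, l⟩ hkl h
    simp_all [C]
  have hHD : ((blk n \ {i}) ×ˢ (blk n)ᶜ) ∪ ((blk n)ᶜ ×ˢ (blk n \ {j})) ⊆ {(i, j)}ᶜ := by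
    rintro ⟨k, l⟩ hkl h
    simp_all
  have hT := hp.measurePreserving (shiftExcept_injective hi) (shiftExcept_injective hj)
  have hmaps : Set.MapsTo (fun kl : ℕ × ℕ => (shiftExcept n i kl.1, shiftExcept n j kl.2))
      {(i, j)}ᶜ C := by
    rintro ⟨k, l⟩ hkl
    by_cases hk : k = i
    · subst hk
      have hl : l ≠ j := fun h => hkl (by simp [h])
      exact Or.inl (Or.inr ⟨shiftExcept_self n k, shiftExcept_mem_compl_blk hl⟩)
    · by_cases hl : l = j
      · subst hl
        exact Or.inl (Or.inl ⟨shiftExcept_mem_compl_blk hk, shiftExcept_self n l⟩)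
      · exact Or.inr ⟨shiftExcept_mem_compl_blk hk, shiftExcept_mem_compl_blk hl⟩
  refine condIndep_of_condExp_ae_eq _ (coordSigma_mono X hCD) (coordSigma_le X _)
    (coordSigma_le X _) (coordSigma_mono X hHD) fun s hs => ?_
  refine condExp_ae_eq_of_comp_measurePreserving hT (comap_coordSigma_le hmaps)
    (coordSigma_mono X hCD) (coordSigma_le X _)
    ((memLp_const 1).indicator (coordSigma_le X _ s hs)) ?_
  rw [coordSigma_singleton] at hs
  obtain ⟨u, -, rfl⟩ := hs
  ext x
  by_cases hx : x (i, j) ∈ u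
  · rw [Function.comp_apply, Set.indicator_of_mem, Set.indicator_of_mem] <;>
      simpa only [Set.mem_preimage, shiftExcept_self] using hx
  · rw [Function.comp_apply, Set.indicator_of_notMem, Set.indicator_of_notMem] <;>
      simpa only [Set.mem_preimage, shiftExcept_self] using hx
end

section
/- Partition Lemma: let Ω be a standard Borel space with a probability measure μ, let (ℱ_i)_{i ∈ 𝒜} be a family of sub-σ-algebras of Ω indexed by a set 𝒜, and let 𝒲 be a further sub-σ-algebra. Let P₁ and P₂ be partitions of 𝒜, and for a subset I ⊆ 𝒜 write ℱ_I = ⋁_{i ∈ I} ℱ_i for the join. If the family (ℱ_I)_{I ∈ P₁} is mutually conditionally independent given 𝒲 and the family (ℱ_J)_{J ∈ P₂} is mutually conditionally independent given 𝒲, then the family (ℱ_K)_{K ∈ P₁ ∨ P₂} indexed by the common refinement P₁ ∨ P₂ (whose blocks are the nonempty intersections I ∩ J with I ∈ P₁, J ∈ P₂) is mutually conditionally independent given 𝒲. -/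
open MeasureTheory ProbabilityTheory

/-- Grouping independent events along a map `g` into the index set of an independent family. -/
theorem ProbabilityTheory.Kernel.iIndep.meas_biInter_fiberwise
    {α Ω β γ : Type*} {mα : MeasurableSpace α} {mΩ : MeasurableSpace Ω} [DecidableEq γ]
    {κ : Kernel α Ω} {μ : Measure α} {m : γ → MeasurableSpace Ω} (h : Kernel.iIndep m κ μ)
    (g : β → γ) (s : Finset β) {f : β → Set Ω} (hf : ∀ k ∈ s, MeasurableSet[m (g k)] (f k)) :
    ∀ᵐ a ∂μ, κ a (⋂ k ∈ s, f k) = ∏ i ∈ s.image g, κ a (⋂ k ∈ s.filter (g · = i), f k) := by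
  have key := h.meas_biInter (S := s.image g) (s := fun i => ⋂ k ∈ s.filter (g · = i), f k)
    (fun i _ => by
      refine MeasurableSet.biInter (Finset.countable_toSet _) fun k hk => ?_
      obtain ⟨hks, rfl⟩ := Finset.mem_filter.1 (Finset.mem_coe.1 hk)
      exact hf k hks)
  have hset : ⋂ i ∈ s.image g, ⋂ k ∈ s.filter (g · = i), f k = ⋂ k ∈ s, f k := by
    ext x
    simp only [Set.mem_iInter, Finset.mem_image, Finset.mem_filter]
    exact ⟨fun hx k hk => hx _ ⟨k, hk, rfl⟩ k ⟨hk, rfl⟩, fun hx _ _ k hk => hx k hk.1⟩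
  rwa [hset] at key

/-- If a family of σ-algebras is indexed so that two maps `g₁`, `g₂` jointly separate its indices,
and each member is contained in the corresponding members of two independent families, then it is
itself independent. -/
theorem ProbabilityTheory.Kernel.iIndep.of_le_of_le
    {α Ω β γ δ : Type*} {mα : MeasurableSpace α} {mΩ : MeasurableSpace Ω}
    {κ : Kernel α Ω} {μ : Measure α} {m : β → MeasurableSpace Ω}
    {m₁ : γ → MeasurableSpace Ω} {m₂ : δ → MeasurableSpace Ω}
    (h₁ : Kernel.iIndep m₁ κ μ) (h₂ : Kernel.iIndep m₂ κ μ) (g₁ : β → γ) (g₂ : β → δ)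
    (hg : ∀ k l, g₁ k = g₁ l → g₂ k = g₂ l → k = l)
    (hm₁ : ∀ k, m k ≤ m₁ (g₁ k)) (hm₂ : ∀ k, m k ≤ m₂ (g₂ k)) :
    Kernel.iIndep m κ μ := by
  classical
  intro s f hf
  have hrow := (Finset.eventually_all (s.image g₁)).2 fun i _ =>
    h₂.meas_biInter_fiberwise g₂ (s.filter (g₁ · = i))
      fun k hk => hm₂ k _ (hf k (Finset.mem_filter.1 hk).1)
  filter_upwards [h₁.meas_biInter_fiberwise g₁ s fun k hk => hm₁ k _ (hf k hk), hrow]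
    with a ha hrow
  rw [ha, ← Finset.prod_fiberwise_of_maps_to (fun k hk => Finset.mem_image_of_mem g₁ hk)]
  refine Finset.prod_congr rfl fun i hi => ?_
  rw [hrow i hi, Finset.prod_image]
  · refine Finset.prod_congr rfl fun k hk => ?_
    have hsingle : (s.filter (g₁ · = i)).filter (g₂ · = g₂ k) = {k} := by
      ext l
      simp only [Finset.mem_filter, Finset.mem_singleton] at hk ⊢
      exact ⟨fun hl => hg l k (hl.1.2.trans hk.2.symm) hl.2, by rintro rfl; exact ⟨hk, rfl⟩⟩
    simp [hsingle]
  · intro k hk l hl hkl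
    rw [Finset.mem_coe, Finset.mem_filter] at hk hl
    exact hg k l (hk.2.trans hl.2.symm) hkl

/-- **Partition Lemma**: let `Ω` be a standard Borel probability space, `(ℱ i)_{i : ι}` a
family of sub-σ-algebras and `𝒲` a further sub-σ-algebra.  Let `P₁`, `P₂` be partitions of
`ι` and for `I ⊆ ι` write `ℱ_I = ⨆ i ∈ I, ℱ i`.  If the family `(ℱ_I)_{I ∈ P₁}` is mutually
conditionally independent given `𝒲` and so is `(ℱ_J)_{J ∈ P₂}`, then the family indexed by
the common refinement `P₁ ∨ P₂` (whose blocks are the nonempty intersections `I ∩ J` with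
`I ∈ P₁`, `J ∈ P₂`) is mutually conditionally independent given `𝒲`. -/
theorem partition_lemma
    {Ω ι : Type*} [mΩ : MeasurableSpace Ω] [StandardBorelSpace Ω]
    (μ : Measure Ω) [IsProbabilityMeasure μ]
    (F : ι → MeasurableSpace Ω) (hF : ∀ i, F i ≤ mΩ)
    (W : MeasurableSpace Ω) (hW : W ≤ mΩ)
    (P₁ P₂ : Set (Set ι)) (hP₁ : Setoid.IsPartition P₁) (hP₂ : Setoid.IsPartition P₂)
    (h₁ : iCondIndep W hW (fun I : P₁ => ⨆ i ∈ (I : Set ι), F i) μ)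
    (h₂ : iCondIndep W hW (fun J : P₂ => ⨆ i ∈ (J : Set ι), F i) μ) :
    iCondIndep W hW
      (fun K : {K : Set ι // K.Nonempty ∧ ∃ I ∈ P₁, ∃ J ∈ P₂, K = I ∩ J} =>
        ⨆ i ∈ (K : Set ι), F i) μ := by
  choose I hI J hJ hK using
    fun K : {K : Set ι // K.Nonempty ∧ ∃ I ∈ P₁, ∃ J ∈ P₂, K = I ∩ J} => K.2.2
  refine Kernel.iIndep.of_le_of_le h₁ h₂ (fun K => ⟨I K, hI K⟩) (fun K => ⟨J K, hJ K⟩) ?_ ?_ ?_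
  · intro K L hIKL hJKL
    apply Subtype.ext
    rw [hK K, hK L, Subtype.mk.inj hIKL, Subtype.mk.inj hJKL]
  · exact fun K => biSup_mono fun i hi => ((hK K).subset hi).1
  · exact fun K => biSup_mono fun i hi => ((hK K).subset hi).2
end

section
/- Aldous–Hoover Theorem (weak form): let X be a standard Borel space and let p be a row-column exchangeable probability measure on ℕ × ℕ → X. Then there exist standard Borel spaces A, B, C, a probability measure q on A, and Markov kernels f : A → B, g : A → C, h : B × A × C → X such that p equals the law of the random array generated as follows: sample a ∼ q; sample (b_i)_{i ∈ ℕ} i.i.d. from f(a) and, independently, (c_j)_{j ∈ ℕ} i.i.d. from g(a); then, conditionally independently over all pairs (i,j), sample the (i,j)-entry from h(b_i, a, c_j). Equivalently, p is the bind of q with the map a ↦ bind of (f a)^{⊗ℕ} ⊗ (g a)^{⊗ℕ} with the map (b,c) ↦ ⨂_{(i,j) ∈ ℕ×ℕ} h(b_i, a, c_j). -/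
open MeasureTheory ProbabilityTheory

/-- `p` admits an Aldous–Hoover representation with standard Borel parameter spaces
`A`, `B`, `C`: there are a probability measure `q` on `A` and Markov kernels `f : A → B`,
`g : A → C`, `h : B × A × C → X` such that `p` is the law of the array generated by
sampling `a ∼ q`, then `(b i)_{i ∈ ℕ}` i.i.d. from `f a` and independently `(c j)_{j ∈ ℕ}`
i.i.d. from `g a` (the kernels `F`, `G` give the corresponding countable product measures
`(f a)^{⊗ℕ}`, `(g a)^{⊗ℕ}`), and finally, conditionally independently over all pairs
`(i, j)`, the `(i,j)`-entry from `h (b i, a, c j)` (the kernel `H` gives the corresponding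
product measure `⨂_{(i,j)} h (b i, a, c j)`). -/
def IsAldousHooverMixture {X : Type*} [MeasurableSpace X] (p : Measure (ℕ × ℕ → X))
    (A B C : Type) [MeasurableSpace A] [MeasurableSpace B] [MeasurableSpace C] : Prop :=
  StandardBorelSpace A ∧ StandardBorelSpace B ∧ StandardBorelSpace C ∧
    ∃ q : Measure A, IsProbabilityMeasure q ∧
      ∃ (f : Kernel A B) (g : Kernel A C) (h : Kernel (B × A × C) X),
        IsMarkovKernel f ∧ IsMarkovKernel g ∧ IsMarkovKernel h ∧
          ∃ (F : Kernel A (ℕ → B)) (G : Kernel A (ℕ → C))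
            (H : Kernel (A × (ℕ → B) × (ℕ → C)) (ℕ × ℕ → X)),
            (∀ a, IsProductMeasure (fun _ : ℕ => f a) (F a)) ∧
            (∀ a, IsProductMeasure (fun _ : ℕ => g a) (G a)) ∧
            (∀ a b c,
              IsProductMeasure (fun ij : ℕ × ℕ => h (b ij.1, a, c ij.2)) (H (a, b, c))) ∧
            p = q.bind (fun a => ((F a).prod (G a)).bind (fun bc => H (a, bc.1, bc.2)))

open scoped ENNReal

namespace AldousHoover

section Generic

variable {Ω : Type*}

/-- If the measure-preserving map `Φ` leaves the set `E` invariant and pulls `𝓖` back into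
`m ≤ 𝓖`, then `E` is conditionally independent of `𝓖` given `m`. -/
theorem condExp_indicator_ae_eq_of_invariant {m 𝓖 mΩ : MeasurableSpace Ω}
    {p : Measure Ω} [IsProbabilityMeasure p] {Φ : Ω → Ω}
    (hΦ : MeasurePreserving Φ p p) (hm : m ≤ 𝓖) (h𝓖 : 𝓖 ≤ mΩ)
    (hΦm : Measurable[m, 𝓖] Φ) {E : Set Ω} (hE : MeasurableSet E) (hinv : Φ ⁻¹' E = E) :
    p⟦E | m⟧ =ᵐ[p] p⟦E | 𝓖⟧ := by
  set u : Ω → ℝ := E.indicator fun _ => 1 with hu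
  set g : Ω → ℝ := p[u | 𝓖] with hg
  have hu_int : Integrable u p := (integrable_const (1 : ℝ)).indicator hE
  have hg_int : Integrable g p := integrable_condExp
  have hg_meas : StronglyMeasurable[𝓖] g := stronglyMeasurable_condExp
  have hgΦ_meas : StronglyMeasurable[m] (g ∘ Φ) :=
    (hg_meas.measurable.comp hΦm).stronglyMeasurable
  have hgΦ_int : Integrable (g ∘ Φ) p := hΦ.integrable_comp_of_integrable hg_int
  have hg_bdd : ∀ᵐ ω ∂p, |g ω| ≤ (1 : ℝ) := by
    refine ae_bdd_abs_condExp_of_ae_bdd_abs (Filter.Eventually.of_forall fun ω => ?_)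
    by_cases h : ω ∈ E <;> simp [hu, h]
  have hgΦ_bdd : ∀ᵐ ω ∂p, |g (Φ ω)| ≤ (1 : ℝ) := hΦ.quasiMeasurePreserving.ae hg_bdd
  have hg_aesm := hg_int.aestronglyMeasurable
  have hgΦ_aesm := hgΦ_int.aestronglyMeasurable
  have hug_int : Integrable (g * u) p := hu_int.bdd_mul hg_aesm hg_bdd
  have huΦ_int : Integrable (g ∘ Φ * u) p := hu_int.bdd_mul hgΦ_aesm hgΦ_bdd
  have hgg_int : Integrable (g * g) p := hg_int.bdd_mul hg_aesm hg_bdd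
  have hggΦ_int : Integrable (g ∘ Φ * g) p := hg_int.bdd_mul hgΦ_aesm hgΦ_bdd
  have hΦΦ_int : Integrable (g ∘ Φ * g ∘ Φ) p := hgΦ_int.bdd_mul hgΦ_aesm hgΦ_bdd
  have hcomp : ∀ w : Ω → ℝ, AEStronglyMeasurable w p → ∫ ω, w (Φ ω) ∂p = ∫ ω, w ω ∂p := by
    intro w hw
    conv_rhs => rw [← hΦ.map_eq]
    rw [integral_map hΦ.measurable.aemeasurable (by rwa [hΦ.map_eq])]
  have hΦΦ : ∫ ω, (g ∘ Φ * g ∘ Φ) ω ∂p = ∫ ω, (g * g) ω ∂p :=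
    hcomp (g * g) hgg_int.aestronglyMeasurable
  have huinv : ∀ ω, u (Φ ω) = u ω := by
    intro ω
    have h : Φ ω ∈ E ↔ ω ∈ E := by rw [← Set.mem_preimage, hinv]
    by_cases hω : ω ∈ E
    · simp [hu, hω, h.2 hω]
    · simp [hu, hω, mt h.1 hω]
  have hgg : ∫ ω, (g * g) ω ∂p = ∫ ω, (g * u) ω ∂p := by
    rw [← integral_condExp h𝓖 (f := g * u)]
    exact (integral_congr_ae (condExp_mul_of_stronglyMeasurable_left hg_meas hug_int hu_int)).symm
  have hggΦ : ∫ ω, (g ∘ Φ * g) ω ∂p = ∫ ω, (g * g) ω ∂p := by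
    calc ∫ ω, (g ∘ Φ * g) ω ∂p = ∫ ω, (g ∘ Φ * u) ω ∂p := by
          rw [← integral_condExp h𝓖 (f := g ∘ Φ * u)]
          exact (integral_congr_ae (condExp_mul_of_stronglyMeasurable_left
            (hgΦ_meas.mono hm) huΦ_int hu_int)).symm
      _ = ∫ ω, (g * u) (Φ ω) ∂p := by simp [huinv]
      _ = ∫ ω, (g * u) ω ∂p := hcomp (g * u) hug_int.aestronglyMeasurable
      _ = ∫ ω, (g * g) ω ∂p := hgg.symm
  have hsq : ∫ ω, (g ω - g (Φ ω)) ^ 2 ∂p = 0 := by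
    have hexp : (fun ω => (g ω - g (Φ ω)) ^ 2)
        = g * g - (2 : ℝ) • (g ∘ Φ * g) + g ∘ Φ * g ∘ Φ := by
      funext ω
      simp only [Pi.add_apply, Pi.sub_apply, Pi.mul_apply, Pi.smul_apply, Function.comp_apply,
        smul_eq_mul]
      ring
    rw [hexp, integral_add' (hgg_int.sub (hggΦ_int.smul (2 : ℝ))) hΦΦ_int,
      integral_sub' hgg_int (hggΦ_int.smul (2 : ℝ)), hΦΦ]
    have h2 : ∫ ω, ((2 : ℝ) • (g ∘ Φ * g)) ω ∂p = 2 * ∫ ω, (g * g) ω ∂p := by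
      rw [← hggΦ, ← integral_const_mul]
      rfl
    rw [h2]
    ring
  have hint : Integrable (fun ω => (g ω - g (Φ ω)) ^ 2) p := by
    have h := (hgg_int.sub (hggΦ_int.smul (2 : ℝ))).add hΦΦ_int
    refine h.congr (Filter.Eventually.of_forall fun ω => ?_)
    simp only [Pi.add_apply, Pi.sub_apply, Pi.mul_apply, Pi.smul_apply, Function.comp_apply,
        smul_eq_mul]
    ring
  have hgΦ : g =ᵐ[p] g ∘ Φ := by
    have h := (integral_eq_zero_iff_of_nonneg (fun ω => sq_nonneg _) hint).1 hsq
    filter_upwards [h] with ω hω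
    exact sub_eq_zero.1 (pow_eq_zero_iff two_ne_zero |>.1 hω)
  calc p[u | m] =ᵐ[p] p[g | m] := (condExp_condExp_of_le hm h𝓖).symm
    _ =ᵐ[p] p[g ∘ Φ | m] := condExp_congr_ae hgΦ
    _ = g ∘ Φ := condExp_of_stronglyMeasurable (hm.trans h𝓖) hgΦ_meas hgΦ_int
    _ =ᵐ[p] g := hgΦ.symm

/-- Under the hypotheses of `condExp_indicator_ae_eq_of_invariant`, the conditional distribution
of `U` given `V` computes the joint probabilities of `U` and events in `𝓖`. -/
theorem measure_inter_preimage_eq_setLIntegral_condDistrib {𝓖 mΩ : MeasurableSpace Ω}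
    {p : Measure Ω} [IsProbabilityMeasure p]
    {𝒰 𝒱 : Type*} [MeasurableSpace 𝒰] [StandardBorelSpace 𝒰] [Nonempty 𝒰]
    {m𝒱 : MeasurableSpace 𝒱} {U : Ω → 𝒰} {V : Ω → 𝒱}
    {Φ : Ω → Ω} (hΦ : MeasurePreserving Φ p p) (h𝓖 : 𝓖 ≤ mΩ)
    (hU : Measurable U) (hV : Measurable[𝓖] V) (hΦV : Measurable[m𝒱.comap V, 𝓖] Φ)
    {T : Set 𝒰} (hT : MeasurableSet T) (hinv : Φ ⁻¹' (U ⁻¹' T) = U ⁻¹' T)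
    {A : Set Ω} (hA : MeasurableSet[𝓖] A) :
    p (A ∩ U ⁻¹' T) = ∫⁻ ω in A, condDistrib U V p (V ω) T ∂p := by
  have hVΩ : Measurable V := hV.mono h𝓖 le_rfl
  have hE : MeasurableSet (U ⁻¹' T) := hU hT
  have h1 : (fun ω => (condDistrib U V p (V ω)).real T) =ᵐ[p] p⟦U ⁻¹' T | 𝓖⟧ :=
    (condDistrib_ae_eq_condExp hVΩ hU hT).trans
      (condExp_indicator_ae_eq_of_invariant hΦ hV.comap_le h𝓖 hΦV hE hinv)
  have h2 : ∫ ω in A, (condDistrib U V p (V ω)).real T ∂p = p.real (A ∩ U ⁻¹' T) := by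
    rw [setIntegral_congr_ae (h𝓖 _ hA) (h1.mono fun ω h _ => h),
      setIntegral_condExp h𝓖 ((integrable_const (1 : ℝ)).indicator hE) hA,
      setIntegral_indicator hE]
    simp
  have hmeas : Measurable fun ω => condDistrib U V p (V ω) T :=
    (Kernel.measurable_coe _ hT).comp hVΩ
  rw [← ENNReal.toReal_eq_toReal_iff' (measure_ne_top _ _)]
  · rw [← measureReal_def, ← h2]
    exact integral_toReal hmeas.aemeasurable
      (Filter.Eventually.of_forall fun ω => measure_lt_top _ _)
  · refine ((setLIntegral_mono measurable_const fun ω _ => prob_le_one).trans_lt ?_).ne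
    simp

/-- A version of `measure_inter_preimage_eq_setLIntegral_condDistrib` in which the invariance is
only required on a generating π-system and the conditional distribution is that of a pair
`(U₀, V₀)` with the same law as `(U, V)`. -/
theorem measure_inter_preimage_eq_of_isPiSystem {𝓖 mΩ : MeasurableSpace Ω}
    {p : Measure Ω} [IsProbabilityMeasure p]
    {𝒰 𝒱 : Type*} [m𝒰 : MeasurableSpace 𝒰] [StandardBorelSpace 𝒰] [Nonempty 𝒰]
    {m𝒱 : MeasurableSpace 𝒱} {U U₀ : Ω → 𝒰} {V V₀ : Ω → 𝒱}
    {Ψ : Ω → Ω} (hΨ : MeasurePreserving Ψ p p) (hUΨ : ∀ ω, U ω = U₀ (Ψ ω))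
    (hVΨ : ∀ ω, V ω = V₀ (Ψ ω)) (hU₀ : Measurable U₀) (hV₀ : Measurable V₀)
    {C : Set (Set 𝒰)} (hC : m𝒰 = MeasurableSpace.generateFrom C) (hCpi : IsPiSystem C)
    (h𝓖 : 𝓖 ≤ mΩ) (hV : Measurable[𝓖] V)
    (hΦ : ∀ T ∈ C, ∃ Φ : Ω → Ω, MeasurePreserving Φ p p ∧ Measurable[m𝒱.comap V, 𝓖] Φ ∧
      Φ ⁻¹' (U ⁻¹' T) = U ⁻¹' T)
    {A : Set Ω} (hA : MeasurableSet[𝓖] A) {T : Set 𝒰} (hT : MeasurableSet T) :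
    p (A ∩ U ⁻¹' T) = ∫⁻ ω in A, condDistrib U₀ V₀ p (V ω) T ∂p := by
  have hU : Measurable U := by
    rw [show U = U₀ ∘ Ψ from funext hUΨ]
    exact hU₀.comp hΨ.measurable
  have hVΩ : Measurable V := hV.mono h𝓖 le_rfl
  have hlaw : condDistrib U₀ V₀ p = condDistrib U V p := by
    rw [condDistrib, condDistrib]
    congr 1
    conv_lhs => rw [← hΨ.map_eq]
    rw [Measure.map_map (hV₀.prodMk hU₀) hΨ.measurable]
    congr 1
    funext ω
    simp [hUΨ, hVΨ]
  rw [hlaw]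
  set κ : Kernel Ω 𝒰 := (condDistrib U V p).comap V hVΩ with hκ
  have hAΩ : MeasurableSet A := h𝓖 _ hA
  have key : (p.restrict A).map U = (p.restrict A).bind κ := by
    refine ext_of_generate_finite C hC hCpi (fun T hTC => ?_) ?_
    · have hT : MeasurableSet T := by
        rw [hC]
        exact MeasurableSpace.measurableSet_generateFrom hTC
      obtain ⟨Φ, hΦ1, hΦ2, hΦ3⟩ := hΦ T hTC
      rw [Measure.map_apply hU hT, Measure.restrict_apply (hU hT), Set.inter_comm,
        Measure.bind_apply hT κ.aemeasurable,
        measure_inter_preimage_eq_setLIntegral_condDistrib hΦ1 h𝓖 hU hV hΦ2 hT hΦ3 hA]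
      rfl
    · rw [Measure.map_apply hU .univ, Measure.bind_apply .univ κ.aemeasurable]
      simp
  have h := congrArg (fun μ => μ T) key
  simp only [Measure.map_apply hU hT, Measure.restrict_apply (hU hT),
    Measure.bind_apply hT κ.aemeasurable] at h
  rw [Set.inter_comm, h]
  rfl

theorem setLIntegral_eq_lintegral_mul_of_forall_measure_inter {𝓖 mΩ : MeasurableSpace Ω}
    {p : Measure Ω} [IsProbabilityMeasure p]
    (h𝓖 : 𝓖 ≤ mΩ) {E : Set Ω} {k W : Ω → ℝ≥0∞} (hk : Measurable k)
    (h : ∀ A, MeasurableSet[𝓖] A → p (A ∩ E) = ∫⁻ ω in A, k ω ∂p) (hW : Measurable[𝓖] W) :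
    ∫⁻ ω in E, W ω ∂p = ∫⁻ ω, k ω * W ω ∂p := by
  have htrim : (p.restrict E).trim h𝓖 = (p.withDensity k).trim h𝓖 := by
    refine @Measure.ext _ 𝓖 _ _ fun A hA => ?_
    rw [trim_measurableSet_eq h𝓖 hA, trim_measurableSet_eq h𝓖 hA,
      Measure.restrict_apply (h𝓖 _ hA), withDensity_apply _ (h𝓖 _ hA), h A hA]
  rw [← lintegral_trim h𝓖 hW, htrim, lintegral_trim h𝓖 hW,
    lintegral_withDensity_eq_lintegral_mul _ hk (hW.mono h𝓖 le_rfl)]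
  rfl

theorem lintegral_prod_indicator_mul {mΩ : MeasurableSpace Ω} {p : Measure Ω}
    [IsProbabilityMeasure p] {ι : Type*}
    {𝓖 : ι → MeasurableSpace Ω}
    (h𝓖 : ∀ i, 𝓖 i ≤ mΩ) {E : ι → Set Ω} {k : ι → Ω → ℝ≥0∞}
    (hE : ∀ i, MeasurableSet (E i))
    (hE' : ∀ i j, i ≠ j → MeasurableSet[𝓖 j] (E i)) (hk : ∀ i j, Measurable[𝓖 j] (k i))
    (h : ∀ i A, MeasurableSet[𝓖 i] A → p (A ∩ E i) = ∫⁻ ω in A, k i ω ∂p)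
    (s : Finset ι) (W : Ω → ℝ≥0∞) (hW : ∀ i, Measurable[𝓖 i] W) :
    ∫⁻ ω, (∏ i ∈ s, (E i).indicator 1 ω) * W ω ∂p = ∫⁻ ω, (∏ i ∈ s, k i ω) * W ω ∂p := by
  classical
  induction s using Finset.induction_on generalizing W with
  | empty => rfl
  | insert i s hi ih =>
    have hrest : Measurable[𝓖 i] fun ω => (∏ j ∈ s, (E j).indicator 1 ω) * W ω := by
      refine @Measurable.mul _ _ _ _ (𝓖 i) (fun ω => ∏ j ∈ s, (E j).indicator 1 ω) W _
        (@Finset.measurable_fun_prod _ _ _ _ _ _ (𝓖 i) _ s fun j hj => ?_) (hW i)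
      exact Measurable.indicator (m := 𝓖 i) measurable_const (hE' j i (by rintro rfl; exact hi hj))
    calc ∫⁻ ω, (∏ j ∈ insert i s, (E j).indicator 1 ω) * W ω ∂p
        = ∫⁻ ω in E i, (∏ j ∈ s, (E j).indicator 1 ω) * W ω ∂p := by
          rw [← lintegral_indicator (hE i)]
          refine lintegral_congr fun ω => ?_
          rw [Finset.prod_insert hi]
          by_cases hω : ω ∈ E i <;> simp [hω]
      _ = ∫⁻ ω, k i ω * ((∏ j ∈ s, (E j).indicator 1 ω) * W ω) ∂p :=
          setLIntegral_eq_lintegral_mul_of_forall_measure_inter (h𝓖 i)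
            ((hk i i).mono (h𝓖 i) le_rfl) (h i) hrest
      _ = ∫⁻ ω, (∏ j ∈ s, (E j).indicator 1 ω) * (k i ω * W ω) ∂p :=
          lintegral_congr fun ω => by ring
      _ = ∫⁻ ω, (∏ j ∈ s, k j ω) * (k i ω * W ω) ∂p := ih _ fun j => (hk i j).mul (hW j)
      _ = ∫⁻ ω, (∏ j ∈ insert i s, k j ω) * W ω ∂p :=
          lintegral_congr fun ω => by rw [Finset.prod_insert hi]; ring

end Generic

section ProductKernel

variable {ι α β : Type*} [MeasurableSpace α] [MeasurableSpace β]

/-- The kernel sending `a` to the product of the probability measures `κ i a`. -/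
noncomputable def productKernel (κ : ι → Kernel α β) [∀ i, IsMarkovKernel (κ i)] :
    Kernel α (ι → β) where
  toFun a := Measure.infinitePi fun i => κ i a
  measurable' := by
    refine Measurable.measure_of_isPiSystem_of_isProbabilityMeasure
      generateFrom_squareCylinders.symm
      (isPiSystem_squareCylinders (fun _ ↦ MeasurableSpace.isPiSystem_measurableSet) (by simp)) ?_
    rintro _ ⟨s, t, ht, rfl⟩
    simp only [Set.mem_pi, Set.mem_univ, forall_const] at ht
    simp_rw [Measure.infinitePi_pi _ fun i _ => ht i]
    exact Finset.measurable_fun_prod s fun i _ => Kernel.measurable_coe _ (ht i)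

variable (κ : ι → Kernel α β) [∀ i, IsMarkovKernel (κ i)]

theorem productKernel_apply (a : α) : productKernel κ a = Measure.infinitePi fun i => κ i a := rfl

instance : IsMarkovKernel (productKernel κ) :=
  ⟨fun a => by rw [productKernel_apply]; infer_instance⟩

theorem isProductMeasure_productKernel (a : α) :
    IsProductMeasure (fun i => κ i a) (productKernel κ a) := by
  intro s t ht
  rw [productKernel_apply, ← Measure.infinitePi_pi _ fun i _ => ht i]
  rfl

end ProductKernel

/-- If, for every `i`, the conditional law of `U i` given `𝓖 i` is `κ i`, where `𝓖 i` contains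
all the information about the `U j` with `j ≠ i`, then the `U i` are conditionally independent. -/
theorem measure_inter_preimage_eq_productKernel {Ω : Type*} {mΩ : MeasurableSpace Ω}
    {p : Measure Ω} [IsProbabilityMeasure p] {ι 𝒰 : Type*} [MeasurableSpace 𝒰]
    {𝓖 : ι → MeasurableSpace Ω} (h𝓖 : ∀ i, 𝓖 i ≤ mΩ) {U : ι → Ω → 𝒰} (hU : ∀ i, Measurable (U i))
    (hU' : ∀ i j, i ≠ j → Measurable[𝓖 j] (U i))
    (κ : ι → Kernel Ω 𝒰) [∀ i, IsMarkovKernel (κ i)]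
    (hκ : ∀ i j T, MeasurableSet T → Measurable[𝓖 j] fun ω => κ i ω T)
    (h : ∀ i A T, MeasurableSet[𝓖 i] A → MeasurableSet T →
      p (A ∩ U i ⁻¹' T) = ∫⁻ ω in A, κ i ω T ∂p)
    {A : Set Ω} (hAΩ : MeasurableSet A) (hA : ∀ i, MeasurableSet[𝓖 i] A)
    {S : Set (ι → 𝒰)} (hS : MeasurableSet S) :
    p (A ∩ {ω | (fun i => U i ω) ∈ S}) = ∫⁻ ω in A, productKernel κ ω S ∂p := by
  have hUm : Measurable fun ω i => U i ω := measurable_pi_lambda _ hU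
  have key : (p.restrict A).map (fun ω i => U i ω) = (p.restrict A).bind (productKernel κ) := by
    refine ext_of_generate_finite _ generateFrom_squareCylinders.symm
      (isPiSystem_squareCylinders (fun _ ↦ MeasurableSpace.isPiSystem_measurableSet) (by simp))
      ?_ ?_
    · rintro _ ⟨s, t, ht, rfl⟩
      simp only [Set.mem_pi, Set.mem_univ, forall_const] at ht
      have hst : MeasurableSet ((s : Set ι).pi t) :=
        MeasurableSet.pi s.countable_toSet fun i _ => ht i
      rw [Measure.map_apply hUm hst, Measure.bind_apply hst (productKernel κ).aemeasurable]
      simp_rw [productKernel_apply, Measure.infinitePi_pi _ fun i _ => ht i]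
      have h1 := lintegral_prod_indicator_mul h𝓖 (fun i => hU i (ht i))
        (fun i j hij => hU' i j hij (ht i)) (fun i j => hκ i j _ (ht i))
        (fun i B hB => h i B _ hB (ht i)) s (A.indicator 1)
        (fun i => Measurable.indicator (m := 𝓖 i) measurable_const (hA i))
      have h2 : ∀ w : Ω → ℝ≥0∞, ∫⁻ ω, w ω * A.indicator 1 ω ∂p = ∫⁻ ω in A, w ω ∂p := by
        intro w
        rw [← lintegral_indicator hAΩ]
        refine lintegral_congr fun ω => ?_
        by_cases hω : ω ∈ A <;> simp [hω]
      rw [h2, h2] at h1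
      rw [← h1, ← lintegral_indicator_one (hUm hst)]
      refine lintegral_congr fun ω => ?_
      by_cases hω : ∀ i ∈ s, U i ω ∈ t i
      · rw [Finset.prod_eq_one fun i hi => by simp [hω i hi]]
        simpa [Set.indicator, Set.mem_pi] using hω
      · have hω' := hω
        push Not at hω
        obtain ⟨i, hi, hiω⟩ := hω
        rw [Finset.prod_eq_zero hi (by simp [hiω])]
        simpa [Set.indicator, Set.mem_pi] using hω'
    · rw [Measure.map_apply hUm .univ, Measure.bind_apply .univ (productKernel κ).aemeasurable]
      simp
  have h' := congrArg (fun μ => μ S) key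
  simp only [Measure.map_apply hUm hS, Measure.restrict_apply (hUm hS),
    Measure.bind_apply hS (productKernel κ).aemeasurable] at h'
  rw [Set.inter_comm, ← h']
  rfl

section Array

variable {X : Type*} [MeasurableSpace X]

/-- Reindex the rows and columns of an array. -/
def reindex (φ ψ : ℕ → ℕ) (x : ℕ × ℕ → X) : ℕ × ℕ → X := fun ij => x (φ ij.1, ψ ij.2)

theorem measurable_reindex (φ ψ : ℕ → ℕ) : Measurable (reindex φ ψ : (ℕ × ℕ → X) → _) :=
  measurable_pi_lambda _ fun _ => measurable_pi_apply _

theorem exists_perm_finite_support_eq_of_lt {φ : ℕ → ℕ} (hφ : Function.Injective φ) (n : ℕ) :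
    ∃ σ : Equiv.Perm ℕ, {m | σ m ≠ m}.Finite ∧ ∀ k < n, σ k = φ k := by
  induction n with
  | zero => exact ⟨1, by simp, by simp⟩
  | succ n ih =>
    obtain ⟨σ, hσ, hσφ⟩ := ih
    refine ⟨Equiv.swap (σ n) (φ n) * σ, ?_, fun k hk => ?_⟩
    · refine (hσ.union (Set.toFinite {σ n, φ n})).subset fun m hm => ?_
      by_contra hcon
      simp only [Set.mem_union, Set.mem_ofPred_eq, Set.mem_insert_iff, Set.mem_singleton_iff,
        not_or, not_not] at hcon
      refine hm ?_
      rw [Equiv.Perm.mul_apply, hcon.1, Equiv.swap_apply_of_ne_of_ne hcon.2.1 hcon.2.2]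
    · rw [Equiv.Perm.mul_apply]
      rcases Nat.lt_succ_iff_lt_or_eq.1 hk with h | rfl
      · rw [hσφ k h, Equiv.swap_apply_of_ne_of_ne (hσφ k h ▸ σ.injective.ne h.ne) (hφ.ne h.ne)]
      · exact Equiv.swap_apply_left _ _

/-- A row-column exchangeable measure is invariant under injective reindexings. -/
theorem measurePreserving_reindex {p : Measure (ℕ × ℕ → X)} [IsProbabilityMeasure p]
    (hp : RowColumnExchangeable p) {φ ψ : ℕ → ℕ} (hφ : Function.Injective φ)
    (hψ : Function.Injective ψ) : MeasurePreserving (reindex φ ψ) p p := by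
  refine ⟨measurable_reindex φ ψ, ?_⟩
  have := Measure.isProbabilityMeasure_map (μ := p) (measurable_reindex φ ψ).aemeasurable
  refine ext_of_generate_finite _ generateFrom_measurableCylinders.symm
    isPiSystem_measurableCylinders (fun T hT => ?_) (by simp)
  have hTm : MeasurableSet T := .of_mem_measurableCylinders hT
  obtain ⟨s, S, hS, rfl⟩ := (mem_measurableCylinders _).1 hT
  obtain ⟨σ, hσ, hσφ⟩ := exists_perm_finite_support_eq_of_lt hφ (s.sup Prod.fst + 1)
  obtain ⟨τ, hτ, hτψ⟩ := exists_perm_finite_support_eq_of_lt hψ (s.sup Prod.snd + 1)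
  have hστ : MeasurePreserving (reindex σ τ : (ℕ × ℕ → X) → _) p p :=
    MeasurePreserving.comp (g := reindex σ id) (f := reindex id τ)
      ⟨measurable_reindex _ _, (hp σ hσ).1⟩ ⟨measurable_reindex _ _, (hp τ hτ).2⟩
  rw [Measure.map_apply (measurable_reindex φ ψ) hTm, ← hστ.measure_preimage hTm.nullMeasurableSet]
  congr 1
  ext x
  simp only [Set.mem_preimage, mem_cylinder]
  have h : s.restrict (reindex φ ψ x) = s.restrict (reindex σ τ x) := by
    funext ij
    have h1 := hσφ _ (Nat.lt_succ_of_le (Finset.le_sup (f := Prod.fst) ij.2))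
    have h2 := hτψ _ (Nat.lt_succ_of_le (Finset.le_sup (f := Prod.snd) ij.2))
    simp only [Finset.restrict, reindex, h1, h2]
  rw [h]

/-- The injection fixing `2 * i + 1` and sending all other indices to even ones. -/
def fixOdd (i k : ℕ) : ℕ := if k = 2 * i + 1 then 2 * i + 1 else 2 * k

theorem fixOdd_injective (i : ℕ) : Function.Injective (fixOdd i) := by
  intro k l h
  unfold fixOdd at h
  split_ifs at h <;> omega

/-- An injection into the even numbers fixing the even numbers below `M`. -/
def fixEven (M k : ℕ) : ℕ := if k < M ∧ k % 2 = 0 then k else 2 * (k + M)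

theorem fixEven_injective (M : ℕ) : Function.Injective (fixEven M) := by
  intro k l h
  unfold fixEven at h
  split_ifs at h <;> omega

theorem exists_fixEven_eq (M k : ℕ) : ∃ l, fixEven M k = 2 * l := by
  unfold fixEven
  split_ifs with h
  · exact ⟨k / 2, by omega⟩
  · exact ⟨k + M, rfl⟩

theorem swap_one_odd_even (i k : ℕ) : Equiv.swap 1 (2 * i + 1) (2 * k) = 2 * k :=
  Equiv.swap_apply_of_ne_of_ne (by omega) (by omega)

variable [StandardBorelSpace X]

/-- The even-even entries of an array, encoded as real numbers. -/
noncomputable def corner (x : ℕ × ℕ → X) (kl : ℕ × ℕ) : ℝ :=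
  embeddingReal X (x (2 * kl.1, 2 * kl.2))

/-- The even entries of the odd row `2 * i + 1`, encoded as real numbers. -/
noncomputable def rowPart (i : ℕ) (x : ℕ × ℕ → X) (l : ℕ) : ℝ :=
  embeddingReal X (x (2 * i + 1, 2 * l))

/-- The even entries of the odd column `2 * j + 1`, encoded as real numbers. -/
noncomputable def colPart (j : ℕ) (x : ℕ × ℕ → X) (k : ℕ) : ℝ :=
  embeddingReal X (x (2 * k, 2 * j + 1))

theorem measurable_corner_cylinderEvents {D : Set (ℕ × ℕ)}
    (hD : ∀ k l, (2 * k, 2 * l) ∈ D) :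
    Measurable[cylinderEvents D] (corner : (ℕ × ℕ → X) → _) :=
  @measurable_pi_lambda _ _ _ (cylinderEvents D) _ _ fun _ =>
    (measurableEmbedding_embeddingReal X).measurable.comp
      (measurable_cylinderEvent_apply (hD _ _))

theorem measurable_rowPart_cylinderEvents {D : Set (ℕ × ℕ)} {i : ℕ}
    (hD : ∀ l, (2 * i + 1, 2 * l) ∈ D) :
    Measurable[cylinderEvents D] (rowPart i : (ℕ × ℕ → X) → _) :=
  @measurable_pi_lambda _ _ _ (cylinderEvents D) _ _ fun _ =>
    (measurableEmbedding_embeddingReal X).measurable.comp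
      (measurable_cylinderEvent_apply (hD _))

theorem measurable_colPart_cylinderEvents {D : Set (ℕ × ℕ)} {j : ℕ}
    (hD : ∀ k, (2 * k, 2 * j + 1) ∈ D) :
    Measurable[cylinderEvents D] (colPart j : (ℕ × ℕ → X) → _) :=
  @measurable_pi_lambda _ _ _ (cylinderEvents D) _ _ fun _ =>
    (measurableEmbedding_embeddingReal X).measurable.comp
      (measurable_cylinderEvent_apply (hD _))

theorem measurable_corner : Measurable (corner : (ℕ × ℕ → X) → _) :=
  (measurable_corner_cylinderEvents (D := Set.univ) (by simp)).mono cylinderEvents_le_pi le_rfl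

theorem measurable_rowPart (i : ℕ) : Measurable (rowPart i : (ℕ × ℕ → X) → _) :=
  (measurable_rowPart_cylinderEvents (D := Set.univ) (by simp)).mono cylinderEvents_le_pi le_rfl

theorem measurable_colPart (j : ℕ) : Measurable (colPart j : (ℕ × ℕ → X) → _) :=
  (measurable_colPart_cylinderEvents (D := Set.univ) (by simp)).mono cylinderEvents_le_pi le_rfl

section MeasurableEntry

variable {m : MeasurableSpace (ℕ × ℕ → X)}

theorem measurable_entry_of_corner (h : Measurable[m] (corner : (ℕ × ℕ → X) → _)) (k l : ℕ) :
    Measurable[m] fun x : ℕ × ℕ → X => x (2 * k, 2 * l) :=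
  (measurableEmbedding_embeddingReal X).measurable_comp_iff.1
    ((measurable_pi_apply (k, l)).comp h)

theorem measurable_entry_of_rowPart {i : ℕ} (h : Measurable[m] (rowPart i : (ℕ × ℕ → X) → _))
    (l : ℕ) : Measurable[m] fun x : ℕ × ℕ → X => x (2 * i + 1, 2 * l) :=
  (measurableEmbedding_embeddingReal X).measurable_comp_iff.1
    ((measurable_pi_apply l).comp h)

theorem measurable_entry_of_colPart {j : ℕ} (h : Measurable[m] (colPart j : (ℕ × ℕ → X) → _))
    (k : ℕ) : Measurable[m] fun x : ℕ × ℕ → X => x (2 * k, 2 * j + 1) :=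
  (measurableEmbedding_embeddingReal X).measurable_comp_iff.1
    ((measurable_pi_apply k).comp h)

end MeasurableEntry

variable {p : Measure (ℕ × ℕ → X)} [IsProbabilityMeasure p]

theorem measure_inter_rowPart_preimage (hp : RowColumnExchangeable p) (i : ℕ)
    {A : Set (ℕ × ℕ → X)} (hA : MeasurableSet[cylinderEvents {s | s.1 ≠ 2 * i + 1}] A)
    {T : Set (ℕ → ℝ)} (hT : MeasurableSet T) :
    p (A ∩ rowPart i ⁻¹' T) = ∫⁻ x in A, condDistrib (rowPart 0) corner p (corner x) T ∂p := by
  refine measure_inter_preimage_eq_of_isPiSystem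
    (measurePreserving_reindex hp (Equiv.swap 1 (2 * i + 1)).injective Function.injective_id)
    (fun x => ?_) (fun x => ?_) (measurable_rowPart 0) measurable_corner
    generateFrom_measurableCylinders.symm isPiSystem_measurableCylinders cylinderEvents_le_pi
    (measurable_corner_cylinderEvents fun k l => by simp; omega) (fun S hS => ?_) hA hT
  · funext l
    simp [rowPart, reindex]
  · funext kl
    simp [corner, reindex, swap_one_odd_even]
  · obtain ⟨s, S, -, rfl⟩ := (mem_measurableCylinders _).1 hS
    refine ⟨reindex (fixOdd i) (fixEven (2 * s.sup id + 1)), measurePreserving_reindex hp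
      (fixOdd_injective i) (fixEven_injective _), ?_, ?_⟩
    · refine measurable_cylinderEvents_iff.2 fun ij hij => ?_
      obtain ⟨l, hl⟩ := exists_fixEven_eq (2 * s.sup id + 1) ij.2
      have hk : fixOdd i ij.1 = 2 * ij.1 := if_neg hij
      simp only [reindex, hk, hl]
      exact measurable_entry_of_corner (comap_measurable _) _ _
    · ext x
      have h : s.restrict (rowPart i (reindex (fixOdd i) (fixEven (2 * s.sup id + 1)) x))
          = s.restrict (rowPart i x) := by
        funext l
        have hl : (l : ℕ) ≤ s.sup id := Finset.le_sup (f := id) l.2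
        have h1 : fixEven (2 * s.sup id + 1) (2 * l) = 2 * l := if_pos (by omega)
        have h2 : fixOdd i (2 * i + 1) = 2 * i + 1 := if_pos rfl
        simp only [Finset.restrict, rowPart, reindex, h1, h2]
      simp only [Set.mem_preimage, mem_cylinder, h]

theorem measure_inter_colPart_preimage (hp : RowColumnExchangeable p) (j : ℕ)
    {A : Set (ℕ × ℕ → X)} (hA : MeasurableSet[cylinderEvents {s | s.2 ≠ 2 * j + 1}] A)
    {T : Set (ℕ → ℝ)} (hT : MeasurableSet T) :
    p (A ∩ colPart j ⁻¹' T) = ∫⁻ x in A, condDistrib (colPart 0) corner p (corner x) T ∂p := by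
  refine measure_inter_preimage_eq_of_isPiSystem
    (measurePreserving_reindex hp Function.injective_id (Equiv.swap 1 (2 * j + 1)).injective)
    (fun x => ?_) (fun x => ?_) (measurable_colPart 0) measurable_corner
    generateFrom_measurableCylinders.symm isPiSystem_measurableCylinders cylinderEvents_le_pi
    (measurable_corner_cylinderEvents fun k l => by simp; omega) (fun S hS => ?_) hA hT
  · funext l
    simp [colPart, reindex]
  · funext kl
    simp [corner, reindex, swap_one_odd_even]
  · obtain ⟨s, S, -, rfl⟩ := (mem_measurableCylinders _).1 hS
    refine ⟨reindex (fixEven (2 * s.sup id + 1)) (fixOdd j), measurePreserving_reindex hp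
      (fixEven_injective _) (fixOdd_injective j), ?_, ?_⟩
    · refine measurable_cylinderEvents_iff.2 fun ij hij => ?_
      obtain ⟨k, hk⟩ := exists_fixEven_eq (2 * s.sup id + 1) ij.1
      have hl : fixOdd j ij.2 = 2 * ij.2 := if_neg hij
      simp only [reindex, hk, hl]
      exact measurable_entry_of_corner (comap_measurable _) _ _
    · ext x
      have h : s.restrict (colPart j (reindex (fixEven (2 * s.sup id + 1)) (fixOdd j) x))
          = s.restrict (colPart j x) := by
        funext k
        have hk : (k : ℕ) ≤ s.sup id := Finset.le_sup (f := id) k.2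
        have h1 : fixEven (2 * s.sup id + 1) (2 * k) = 2 * k := if_pos (by omega)
        have h2 : fixOdd j (2 * j + 1) = 2 * j + 1 := if_pos rfl
        simp only [Finset.restrict, colPart, reindex, h1, h2]
      simp only [Set.mem_preimage, mem_cylinder, h]

/-- The data on which the odd-odd entry `(2 * i + 1, 2 * j + 1)` depends. -/
noncomputable def entryData (i j : ℕ) (x : ℕ × ℕ → X) : (ℕ → ℝ) × (ℕ × ℕ → ℝ) × (ℕ → ℝ) :=
  (rowPart i x, corner x, colPart j x)

theorem measurable_entryData (i j : ℕ) : Measurable (entryData i j : (ℕ × ℕ → X) → _) :=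
  (measurable_rowPart i).prodMk (measurable_corner.prodMk (measurable_colPart j))

theorem measurable_entryData_cylinderEvents (i j : ℕ) (ij : ℕ × ℕ) :
    Measurable[cylinderEvents {(2 * ij.1 + 1, 2 * ij.2 + 1)}ᶜ]
      (entryData i j : (ℕ × ℕ → X) → _) := by
  refine Measurable.prodMk (measurable_rowPart_cylinderEvents fun l => ?_)
    (Measurable.prodMk (measurable_corner_cylinderEvents fun k l => ?_)
      (measurable_colPart_cylinderEvents fun k => ?_)) <;>
  · simp only [Set.mem_compl_iff, Set.mem_singleton_iff, Prod.mk.injEq]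
    omega

theorem measure_inter_entry_preimage [Nonempty X] (hp : RowColumnExchangeable p) (i j : ℕ)
    {A : Set (ℕ × ℕ → X)} (hA : MeasurableSet[cylinderEvents {(2 * i + 1, 2 * j + 1)}ᶜ] A)
    {T : Set X} (hT : MeasurableSet T) :
    p (A ∩ (fun x => x (2 * i + 1, 2 * j + 1)) ⁻¹' T) =
      ∫⁻ x in A, condDistrib (fun x => x (1, 1)) (entryData 0 0) p (entryData i j x) T ∂p := by
  refine measure_inter_preimage_eq_of_isPiSystem (C := {S | MeasurableSet S})
    (measurePreserving_reindex hp (Equiv.swap 1 (2 * i + 1)).injective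
      (Equiv.swap 1 (2 * j + 1)).injective)
    (fun x => ?_) (fun x => ?_) (measurable_pi_apply _) (measurable_entryData 0 0)
    MeasurableSpace.generateFrom_measurableSet.symm MeasurableSpace.isPiSystem_measurableSet
    cylinderEvents_le_pi (measurable_entryData_cylinderEvents i j (i, j)) (fun S _ => ?_) hA hT
  · simp [reindex]
  · refine Prod.ext ?_ (Prod.ext ?_ ?_) <;> funext k <;>
      simp [entryData, rowPart, corner, colPart, reindex, swap_one_odd_even]
  · refine ⟨reindex (fixOdd i) (fixOdd j), measurePreserving_reindex hp
      (fixOdd_injective i) (fixOdd_injective j), ?_, ?_⟩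
    · have hV : Measurable[MeasurableSpace.comap (entryData i j) inferInstance]
          (entryData i j : (ℕ × ℕ → X) → _) := comap_measurable _
      have hrow := measurable_fst.comp hV
      have hcorner := (measurable_fst.comp measurable_snd).comp hV
      have hcol := (measurable_snd.comp measurable_snd).comp hV
      refine measurable_cylinderEvents_iff.2 fun kl hkl => ?_
      obtain ⟨k, l⟩ := kl
      have hkl' : ¬ (k = 2 * i + 1 ∧ l = 2 * j + 1) := fun h => hkl (by simp [h])
      simp only [reindex, fixOdd]
      split_ifs with hk hl hl
      · exact absurd ⟨hk, hl⟩ hkl'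
      · exact measurable_entry_of_rowPart hrow _
      · exact measurable_entry_of_colPart hcol _
      · exact measurable_entry_of_corner hcorner _ _
    · ext x
      simp [reindex, fixOdd]

/-- If `f` and `g` are the conditional laws of the row parts and of the column parts, then,
conditionally on the corner, the row parts and the column parts are independent families of
independent random sequences with laws `f` and `g`. -/
theorem map_corner_rowPart_colPart (f g : Kernel (ℕ × ℕ → ℝ) (ℕ → ℝ)) [IsMarkovKernel f]
    [IsMarkovKernel g]
    (hf : ∀ (i : ℕ) (A : Set (ℕ × ℕ → X)) (T : Set (ℕ → ℝ)),
      MeasurableSet[cylinderEvents {s | s.1 ≠ 2 * i + 1}] A → MeasurableSet T →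
      p (A ∩ rowPart i ⁻¹' T) = ∫⁻ x in A, f (corner x) T ∂p)
    (hg : ∀ (j : ℕ) (A : Set (ℕ × ℕ → X)) (T : Set (ℕ → ℝ)),
      MeasurableSet[cylinderEvents {s | s.2 ≠ 2 * j + 1}] A → MeasurableSet T →
      p (A ∩ colPart j ⁻¹' T) = ∫⁻ x in A, g (corner x) T ∂p) :
    p.map (fun x => (corner x, (fun i => rowPart i x), fun j => colPart j x)) =
      p.map corner ⊗ₘ (productKernel (fun _ : ℕ => f) ×ₖ productKernel fun _ : ℕ => g) := by
  set F := productKernel fun _ : ℕ => f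
  set G := productKernel fun _ : ℕ => g
  have hrows : Measurable fun (x : ℕ × ℕ → X) i => rowPart i x :=
    measurable_pi_lambda _ measurable_rowPart
  have hcols : Measurable fun (x : ℕ × ℕ → X) j => colPart j x :=
    measurable_pi_lambda _ measurable_colPart
  have hmeas := measurable_corner.prodMk (hrows.prodMk hcols)
  have := Measure.isProbabilityMeasure_map (μ := p) hmeas.aemeasurable
  have hcornerRow : ∀ i, Measurable[cylinderEvents {s | s.1 ≠ 2 * i + 1}]
      (corner : (ℕ × ℕ → X) → _) :=
    fun i => measurable_corner_cylinderEvents fun k l => by simp; omega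
  have hcornerCol : ∀ j, Measurable[cylinderEvents {s | s.2 ≠ 2 * j + 1}]
      (corner : (ℕ × ℕ → X) → _) :=
    fun j => measurable_corner_cylinderEvents fun k l => by simp; omega
  have h𝓖r : ∀ i : ℕ, cylinderEvents {s : ℕ × ℕ | s.1 ≠ 2 * i + 1} ≤
      (inferInstance : MeasurableSpace (ℕ × ℕ → X)) := fun _ => cylinderEvents_le_pi
  have h𝓖c : ∀ j : ℕ, cylinderEvents {s : ℕ × ℕ | s.2 ≠ 2 * j + 1} ≤
      (inferInstance : MeasurableSpace (ℕ × ℕ → X)) := fun _ => cylinderEvents_le_pi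
  refine Measure.ext_prod₃ fun {s t u} hs ht hu => ?_
  have hF : ∀ A, MeasurableSet[MeasurableSpace.comap corner inferInstance] A →
      p (A ∩ {x | (fun i => rowPart i x) ∈ t}) = ∫⁻ x in A, F (corner x) t ∂p := by
    intro A hA
    have hA' : ∀ i, MeasurableSet[cylinderEvents {s | s.1 ≠ 2 * i + 1}] A :=
      fun i => (hcornerRow i).comap_le A hA
    exact measure_inter_preimage_eq_productKernel h𝓖r measurable_rowPart
      (fun i j hij => measurable_rowPart_cylinderEvents fun l => by simp; omega)
      (fun _ => f.comap corner measurable_corner)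
      (fun _ j _ hT => (f.measurable_coe hT).comp (hcornerRow j))
      hf (measurable_corner.comap_le A hA) hA' ht
  have hG : p ((corner ⁻¹' s ∩ {x | (fun i => rowPart i x) ∈ t}) ∩
      {x | (fun j => colPart j x) ∈ u}) =
      ∫⁻ x in corner ⁻¹' s ∩ {x | (fun i => rowPart i x) ∈ t}, G (corner x) u ∂p :=
    measure_inter_preimage_eq_productKernel h𝓖c measurable_colPart
      (fun i j hij => measurable_colPart_cylinderEvents fun l => by simp; omega)
      (fun _ => g.comap corner measurable_corner)
      (fun _ j _ hT => (g.measurable_coe hT).comp (hcornerCol j))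
      hg
      ((measurable_corner hs).inter (hrows ht))
      (fun j => (hcornerCol j hs).inter ((@measurable_pi_lambda _ _ _ (cylinderEvents _) _ _
        fun i => measurable_rowPart_cylinderEvents fun l => by simp; omega) ht)) hu
  have hGm : Measurable fun a => G a u := Kernel.measurable_coe _ hu
  have hFm : Measurable fun a => F a t := Kernel.measurable_coe _ ht
  rw [Measure.map_apply hmeas (hs.prod (ht.prod hu)),
    Measure.compProd_apply_prod hs (ht.prod hu)]
  simp_rw [Kernel.prod_apply, Measure.prod_prod]
  have hFG : Measurable fun a => F a t * G a u := hFm.mul hGm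
  rw [setLIntegral_map hs hFG measurable_corner]
  calc p ((fun x => (corner x, (fun i => rowPart i x), fun j => colPart j x)) ⁻¹' s ×ˢ t ×ˢ u)
      = p ((corner ⁻¹' s ∩ {x | (fun i => rowPart i x) ∈ t}) ∩
          {x | (fun j => colPart j x) ∈ u}) := by
        congr 1
        ext x
        simp [and_assoc]
    _ = ∫⁻ x in {x | (fun i => rowPart i x) ∈ t},
          (corner ⁻¹' s).indicator (fun x => G (corner x) u) x ∂p := by
        rw [hG, Set.inter_comm, setLIntegral_indicator (measurable_corner hs), Set.inter_comm]
    _ = ∫⁻ x, F (corner x) t * (corner ⁻¹' s).indicator (fun x => G (corner x) u) x ∂p :=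
        setLIntegral_eq_lintegral_mul_of_forall_measure_inter measurable_corner.comap_le
          (hFm.comp measurable_corner) hF
          ((hGm.comp (comap_measurable _)).indicator (comap_measurable _ hs))
    _ = ∫⁻ x in corner ⁻¹' s, F (corner x) t * G (corner x) u ∂p := by
        rw [← lintegral_indicator (measurable_corner hs)]
        refine lintegral_congr fun x => ?_
        by_cases hx : x ∈ corner ⁻¹' s <;> simp [hx]

end Array

end AldousHoover

open AldousHoover

/-- **Aldous–Hoover Theorem (weak form)**: every row-column exchangeable probability
measure on `ℕ × ℕ → X`, with `X` standard Borel, admits an Aldous–Hoover representation. -/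
theorem aldousHoover_weak {X : Type*} [MeasurableSpace X] [StandardBorelSpace X]
    (p : Measure (ℕ × ℕ → X)) [IsProbabilityMeasure p] (hp : RowColumnExchangeable p) :
    ∃ (A B C : Type) (mA : MeasurableSpace A) (mB : MeasurableSpace B)
      (mC : MeasurableSpace C), @IsAldousHooverMixture X _ p A B C mA mB mC := by
  obtain ⟨x₀⟩ := nonempty_of_isProbabilityMeasure p
  have : Nonempty X := ⟨x₀ (0, 0)⟩
  let f : Kernel (ℕ × ℕ → ℝ) (ℕ → ℝ) := condDistrib (rowPart 0) corner p
  let g : Kernel (ℕ × ℕ → ℝ) (ℕ → ℝ) := condDistrib (colPart 0) corner p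
  let h : Kernel ((ℕ → ℝ) × (ℕ × ℕ → ℝ) × (ℕ → ℝ)) X :=
    condDistrib (fun x => x (1, 1)) (entryData 0 0) p
  have hsel : ∀ ij : ℕ × ℕ, Measurable
      fun z : (ℕ × ℕ → ℝ) × (ℕ → ℕ → ℝ) × (ℕ → ℕ → ℝ) => (z.2.1 ij.1, z.1, z.2.2 ij.2) := by
    fun_prop
  let F := productKernel fun _ : ℕ => f
  let G := productKernel fun _ : ℕ => g
  let H := productKernel fun ij : ℕ × ℕ => h.comap _ (hsel ij)
  refine ⟨ℕ × ℕ → ℝ, ℕ → ℝ, ℕ → ℝ, inferInstance, inferInstance, inferInstance, inferInstance,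
    inferInstance, inferInstance, p.map corner,
    Measure.isProbabilityMeasure_map measurable_corner.aemeasurable, f, g, h, inferInstance,
    inferInstance, inferInstance, F, G, H, fun a => isProductMeasure_productKernel _ a,
    fun a => isProductMeasure_productKernel _ a,
    fun a b c => isProductMeasure_productKernel _ (a, b, c), ?_⟩
  have hdata : Measurable
      fun x : ℕ × ℕ → X => (corner x, (fun i => rowPart i x), fun j => colPart j x) :=
    measurable_corner.prodMk ((measurable_pi_lambda _ measurable_rowPart).prodMk
      (measurable_pi_lambda _ measurable_colPart))
  have hodd : Function.Injective fun k : ℕ => 2 * k + 1 := fun k l h => by simpa using h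
  have hne : ∀ i j : ℕ × ℕ, i ≠ j →
      (2 * i.1 + 1, 2 * i.2 + 1) ∈ ({(2 * j.1 + 1, 2 * j.2 + 1)}ᶜ : Set (ℕ × ℕ)) :=
    fun i j hij h => hij <| by simpa [Prod.ext_iff] using h
  have hbind : ∀ S, MeasurableSet S → ∀ a, ((F a).prod (G a)).bind (fun bc => H (a, bc.1, bc.2)) S
      = ∫⁻ bc, H (a, bc) S ∂(F ×ₖ G) a := by
    intro S hS a
    have hHa : Measurable fun bc : (ℕ → ℕ → ℝ) × (ℕ → ℕ → ℝ) => H (a, bc.1, bc.2) :=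
      H.measurable.comp measurable_prodMk_left
    rw [Measure.bind_apply hS hHa.aemeasurable,
      Kernel.prod_apply]
  have hbind_meas : Measurable fun a =>
      ((F a).prod (G a)).bind (fun bc => H (a, bc.1, bc.2)) := by
    refine Measure.measurable_of_measurable_coe _ fun S hS => ?_
    simp_rw [hbind S hS]
    exact Measurable.lintegral_kernel_prod_right (H.measurable_coe hS)
  ext S hS
  rw [Measure.bind_apply hS hbind_meas.aemeasurable]
  simp_rw [hbind S hS]
  calc p S = p (Set.univ ∩ {x | (fun ij : ℕ × ℕ => x (2 * ij.1 + 1, 2 * ij.2 + 1)) ∈ S}) := by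
        rw [Set.univ_inter]
        exact ((measurePreserving_reindex hp hodd hodd).measure_preimage
          hS.nullMeasurableSet).symm
    _ = ∫⁻ x in Set.univ,
          H (corner x, (fun i => rowPart i x), fun j => colPart j x) S ∂p :=
        measure_inter_preimage_eq_productKernel
          (𝓖 := fun ij : ℕ × ℕ => cylinderEvents {(2 * ij.1 + 1, 2 * ij.2 + 1)}ᶜ)
          (U := fun ij x => x (2 * ij.1 + 1, 2 * ij.2 + 1))
          (fun _ => cylinderEvents_le_pi) (fun _ => measurable_pi_apply _)
          (fun i j hij => measurable_cylinderEvent_apply (hne i j hij))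
          (fun ij : ℕ × ℕ => h.comap (entryData ij.1 ij.2) (measurable_entryData ij.1 ij.2))
          (fun i j T hT =>
            (h.measurable_coe hT).comp (measurable_entryData_cylinderEvents i.1 i.2 j))
          (fun ij A T hA hT => measure_inter_entry_preimage hp ij.1 ij.2 hA hT)
          .univ (fun _ => .univ) hS
    _ = ∫⁻ z, H z S ∂p.map (fun x => (corner x, (fun i => rowPart i x), fun j => colPart j x)) := by
        rw [setLIntegral_univ, lintegral_map (H.measurable_coe hS) hdata]
    _ = ∫⁻ a, ∫⁻ bc, H (a, bc) S ∂(F ×ₖ G) a ∂p.map corner := by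
        have := Measure.isProbabilityMeasure_map (μ := p) measurable_corner.aemeasurable
        rw [map_corner_rowPart_colPart f g
            (fun i _ _ hA hT => measure_inter_rowPart_preimage hp i hA hT)
            (fun j _ _ hA hT => measure_inter_colPart_preimage hp j hA hT),
          Measure.lintegral_compProd (H.measurable_coe hS)]
end
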